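/- arXiv:2510.16728 — 7 statements merged into one kernel-verified Lean document; each statement's English description precedes it below -/
import Mathlib

section
/- Let δ ∈ (0,1), β ∈ (0,1], L > 0, and suppose F belongs to the Hölder class 𝓕_β^ρ with constant L. Fix x ∈ 𝒳 and h > 0 with φ_x(h) > 0, and suppose the sample size satisfies M ≥ 16·B·log(6/δ)/(b·φ_x(h)). Then with probability at least 1 − δ over the i.i.d. sample, |F̂(x) − F(x)| ≤ L·(B/b)·h^β + 8·R·√(2·B·log(6/δ)/(b·φ_x(h)·M)). (The paper states this with Hölder constant L = 1.) -/
open MeasureTheory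

/-- **Bernstein-type Chernoff bound** for a sum of i.i.d. copies of `g`, in terms of upper bounds
on its first two moments and a free parameter `t` with `t * |g| ≤ 1`. -/
theorem measureReal_pi_sum_ge_le_exp {Ω ι : Type*} [MeasurableSpace Ω] [Fintype ι]
    (P : Measure Ω) [IsProbabilityMeasure P] {g : Ω → ℝ} (hg : Measurable g)
    {t m v : ℝ} (ht : 0 < t) (hbound : ∀ᵐ p ∂P, |t * g p| ≤ 1)
    (hm : ∫ p, g p ∂P ≤ m) (hv : ∫ p, g p ^ 2 ∂P ≤ v) (ε : ℝ) :
    (Measure.pi fun _ : ι => P).real {ω | ε ≤ ∑ i, g (ω i)}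
      ≤ Real.exp (-t * ε + Fintype.card ι * (t * m + t ^ 2 * v)) := by
  have hg_le : ∀ᵐ p ∂P, ‖g p‖ ≤ 1 / t := by
    filter_upwards [hbound] with p hp
    rw [abs_mul, abs_of_pos ht] at hp
    rw [Real.norm_eq_abs, le_div_iff₀ ht]
    linarith
  have hg_int : Integrable g P := .of_bound hg.aestronglyMeasurable (1 / t) hg_le
  have hg2_int : Integrable (fun p => g p ^ 2) P := by
    refine .of_bound (hg.pow_const 2).aestronglyMeasurable ((1 / t) ^ 2) ?_
    filter_upwards [hg_le] with p hp
    rw [norm_pow]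
    gcongr
  have hexp_int : Integrable (fun p => Real.exp (t * g p)) P := by
    refine .of_bound (by fun_prop) (Real.exp 1) ?_
    filter_upwards [hbound] with p hp
    rw [Real.norm_eq_abs, Real.abs_exp]
    exact Real.exp_le_exp.2 ((le_abs_self _).trans hp)
  have hmgf_one : ∫ p, Real.exp (t * g p) ∂P ≤ Real.exp (t * m + t ^ 2 * v) := by
    have hlin_int : Integrable (fun p => 1 + t * g p) P :=
      (integrable_const 1).add (hg_int.const_mul t)
    have hle : ∫ p, Real.exp (t * g p) ∂P ≤ ∫ p, (1 + t * g p + t ^ 2 * g p ^ 2) ∂P := by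
      refine integral_mono_ae hexp_int
        (hlin_int.add (hg2_int.const_mul (t ^ 2))) ?_
      filter_upwards [hbound] with p hp
      have := (abs_le.1 (Real.abs_exp_sub_one_sub_id_le hp)).2
      linarith [mul_pow t (g p) 2]
    rw [integral_add hlin_int (hg2_int.const_mul (t ^ 2)),
      integral_add (integrable_const 1) (hg_int.const_mul t), integral_const_mul,
      integral_const_mul] at hle
    simp only [integral_const, probReal_univ, smul_eq_mul, mul_one] at hle
    have h1 : t * ∫ p, g p ∂P ≤ t * m := by gcongr
    have h2 : t ^ 2 * ∫ p, g p ^ 2 ∂P ≤ t ^ 2 * v := by gcongr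
    linarith [Real.add_one_le_exp (t * m + t ^ 2 * v)]
  have hsum : (fun ω : ι → Ω => Real.exp (t * ∑ i, g (ω i)))
      = fun ω => ∏ i, Real.exp (t * g (ω i)) := by
    ext ω
    rw [Finset.mul_sum, Real.exp_sum]
  have hmarkov := ProbabilityTheory.measure_ge_le_exp_mul_mgf
    (μ := Measure.pi fun _ : ι => P) (X := fun ω => ∑ i, g (ω i)) ε ht.le
    (by rw [hsum]; exact Integrable.fintype_prod fun _ => hexp_int)
  refine hmarkov.trans ?_
  rw [ProbabilityTheory.mgf, hsum, integral_fintype_prod_eq_pow (fun p => Real.exp (t * g p)),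
    Real.exp_add, Real.exp_nat_mul]
  have h0 : 0 ≤ ∫ p, Real.exp (t * g p) ∂P := integral_nonneg fun _ => (Real.exp_pos _).le
  gcongr

/-- Concentration of a self-normalised weighted average with weights `k ∈ [0, B]` around the
centre `c` for which `(Y - c) * k` has mean zero. -/
theorem measureReal_pi_weighted_average_ge {Ω : Type*} [MeasurableSpace Ω]
    (P : Measure Ω) [IsProbabilityMeasure P] {Y k : Ω → ℝ} (hY_meas : Measurable Y)
    (hk_meas : Measurable k) {R B c q δ : ℝ} (hR : 0 < R) (hB : 0 < B) (hq : 0 < q)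
    (hδ : δ ∈ Set.Ioo (0 : ℝ) 1) (hY : ∀ᵐ p ∂P, |Y p| ≤ R) (hk_nonneg : ∀ p, 0 ≤ k p)
    (hk_le : ∀ p, k p ≤ B) (hc : |c| ≤ R) (hcenter : ∫ p, (Y p - c) * k p ∂P = 0)
    (hqk : q ≤ ∫ p, k p ∂P) {M : ℕ} (hM : 16 * B * Real.log (6 / δ) / q ≤ M) :
    1 - δ ≤ (Measure.pi fun _ : Fin M => P).real
      {ω | |(∑ i, Y (ω i) * k (ω i)) / (∑ i, k (ω i)) - c|
        ≤ 8 * R * Real.sqrt (2 * B * Real.log (6 / δ) / (q * M))} := by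
  obtain ⟨hδ0, hδ1⟩ := hδ
  set l := Real.log (6 / δ) with hl_def
  have hl : 0 < l := Real.log_pos (by rw [lt_div_iff₀ hδ0]; linarith)
  have hexp_l : Real.exp (-l) = δ / 6 := by
    rw [hl_def, ← Real.log_inv, Real.exp_log (by positivity), inv_div]
  have hMpos : (0 : ℝ) < M := lt_of_lt_of_le (by positivity) hM
  have hMq : 16 * B * l ≤ M * q := by rwa [div_le_iff₀ hq] at hM
  set s := Real.sqrt (2 * B * l / (q * M)) with hs_def
  have hs : 0 < s := Real.sqrt_pos.2 (by positivity)
  have hs_sq : s ^ 2 = 2 * B * l / (q * M) := Real.sq_sqrt (by positivity)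
  have hs_sq' : s ^ 2 * (q * M) = 2 * B * l := by
    rw [hs_sq]; field_simp
  have hs1 : s ≤ 1 := by
    rw [hs_def, Real.sqrt_le_one, div_le_one (by positivity)]
    nlinarith
  set p₀ := ∫ p, k p ∂P with hp₀_def
  have hp₀ : 0 < p₀ := hq.trans_le hqk
  have hk_int : Integrable k P := .of_bound hk_meas.aestronglyMeasurable B
    (.of_forall fun p => by rw [Real.norm_eq_abs, abs_of_nonneg (hk_nonneg p)]; exact hk_le p)
  have hk_sq : ∀ p, k p ^ 2 ≤ B * k p := fun p => by
    nlinarith [hk_nonneg p, hk_le p]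
  have hYc : ∀ᵐ p ∂P, |Y p - c| ≤ 2 * R := by
    filter_upwards [hY] with p hp
    linarith [abs_sub (Y p) c]
  set W : Ω → ℝ := fun p => (Y p - c) * k p with hW_def
  have hW_meas : Measurable W := (hY_meas.sub_const c).mul hk_meas
  have hW_le : ∀ᵐ p ∂P, |W p| ≤ 2 * R * B := by
    filter_upwards [hYc] with p hp
    rw [hW_def]
    simp only [abs_mul, abs_of_nonneg (hk_nonneg p)]
    exact mul_le_mul hp (hk_le p) (hk_nonneg p) (by positivity)
  have hW_sq : ∫ p, W p ^ 2 ∂P ≤ 4 * R ^ 2 * B * p₀ := by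
    rw [hp₀_def, ← integral_const_mul]
    refine integral_mono_of_nonneg (.of_forall fun p => sq_nonneg _) (hk_int.const_mul _) ?_
    filter_upwards [hYc] with p hp
    have h1 : (Y p - c) ^ 2 ≤ (2 * R) ^ 2 := sq_le_sq' (abs_le.1 hp).1 (abs_le.1 hp).2
    calc W p ^ 2 = (Y p - c) ^ 2 * k p ^ 2 := mul_pow _ _ _
      _ ≤ (2 * R) ^ 2 * (B * k p) := by gcongr; exact hk_sq p
      _ = 4 * R ^ 2 * B * k p := by ring
  have hden : (Measure.pi fun _ : Fin M => P).real {ω | -(M * p₀ / 2) ≤ ∑ i, -k (ω i)}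
      ≤ δ / 6 := by
    refine (measureReal_pi_sum_ge_le_exp P hk_meas.neg (t := 1 / (4 * B)) (m := -p₀)
      (v := B * p₀) (by positivity) (.of_forall fun p => ?_) ?_ ?_ _).trans ?_
    · rw [Pi.neg_apply, mul_neg, abs_neg, abs_of_nonneg (mul_nonneg (by positivity) (hk_nonneg p)),
        one_div, inv_mul_le_iff₀ (by positivity)]
      linarith [hk_le p]
    · simp only [Pi.neg_apply, integral_neg]
      exact le_rfl
    · simp only [Pi.neg_apply, neg_sq]
      rw [hp₀_def, ← integral_const_mul]
      exact integral_mono_of_nonneg (.of_forall fun p => sq_nonneg _) (hk_int.const_mul _)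
        (.of_forall hk_sq)
    · rw [← hexp_l, Real.exp_le_exp, Fintype.card_fin]
      have h1 : -(1 / (4 * B)) * -(M * p₀ / 2)
          + M * (1 / (4 * B) * -p₀ + (1 / (4 * B)) ^ 2 * (B * p₀)) = -(M * p₀ / (16 * B)) := by
        field_simp
        ring
      rw [h1, neg_le_neg_iff, le_div_iff₀ (by positivity)]
      nlinarith [mul_le_mul_of_nonneg_left hqk hMpos.le]
  have hexponent : -(s / (2 * R * B)) * (4 * R * M * p₀ * s)
      + M * (s / (2 * R * B) * 0 + (s / (2 * R * B)) ^ 2 * (4 * R ^ 2 * B * p₀)) ≤ -l := by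
    have h1 : -(s / (2 * R * B)) * (4 * R * M * p₀ * s)
        + M * (s / (2 * R * B) * 0 + (s / (2 * R * B)) ^ 2 * (4 * R ^ 2 * B * p₀))
        = -(s ^ 2 * (p₀ * M) / B) := by
      field_simp
      ring
    rw [h1, neg_le_neg_iff, le_div_iff₀ hB]
    have h2 : s ^ 2 * (q * M) ≤ s ^ 2 * (p₀ * M) := by gcongr
    nlinarith [mul_pos hl hB]
  have htW : ∀ᵐ p ∂P, |s / (2 * R * B) * W p| ≤ 1 := by
    filter_upwards [hW_le] with p hp
    rw [abs_mul, abs_of_pos (by positivity), div_mul_eq_mul_div, div_le_one (by positivity)]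
    nlinarith [abs_nonneg (W p)]
  have hnum_upper : (Measure.pi fun _ : Fin M => P).real
      {ω | 4 * R * M * p₀ * s ≤ ∑ i, W (ω i)} ≤ δ / 6 := by
    refine (measureReal_pi_sum_ge_le_exp P hW_meas (by positivity) htW hcenter.le hW_sq _).trans ?_
    rw [← hexp_l, Real.exp_le_exp, Fintype.card_fin]
    exact hexponent
  have hnum_lower : (Measure.pi fun _ : Fin M => P).real
      {ω | 4 * R * M * p₀ * s ≤ ∑ i, -W (ω i)} ≤ δ / 6 := by
    refine (measureReal_pi_sum_ge_le_exp P hW_meas.neg (t := s / (2 * R * B)) (m := 0)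
      (v := 4 * R ^ 2 * B * p₀) (by positivity) (by simpa using htW) ?_ (by simpa using hW_sq)
      _).trans ?_
    · simp only [Pi.neg_apply, integral_neg]
      exact (neg_eq_zero.2 hcenter).le
    · rw [← hexp_l, Real.exp_le_exp, Fintype.card_fin]
      exact hexponent
  set good := {ω : Fin M → Ω | |(∑ i, Y (ω i) * k (ω i)) / (∑ i, k (ω i)) - c| ≤ 8 * R * s}
  have hcover : (Set.univ : Set (Fin M → Ω)) ⊆ good ∪ ({ω | -(M * p₀ / 2) ≤ ∑ i, -k (ω i)}
      ∪ ({ω | 4 * R * M * p₀ * s ≤ ∑ i, W (ω i)}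
      ∪ {ω | 4 * R * M * p₀ * s ≤ ∑ i, -W (ω i)})) := by
    intro ω _
    by_contra hω
    simp only [Set.mem_union, Set.mem_ofPred_eq, not_or, not_le, Finset.sum_neg_distrib,
      neg_lt_neg_iff] at hω
    obtain ⟨hbad, hk, hW_upper, hW_lower⟩ := hω
    refine hbad ?_
    have hkpos : 0 < ∑ i, k (ω i) := lt_trans (by positivity) hk
    have hsum : (∑ i, Y (ω i) * k (ω i)) / (∑ i, k (ω i)) - c
        = (∑ i, W (ω i)) / (∑ i, k (ω i)) := by
      simp only [hW_def, sub_mul, Finset.sum_sub_distrib, ← Finset.mul_sum]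
      field_simp
    rw [Set.mem_ofPred_eq, hsum, abs_div, abs_of_pos hkpos, div_le_iff₀ hkpos]
    have hRs : 0 < 8 * R * s := by positivity
    have hscale : 4 * R * M * p₀ * s ≤ 8 * R * s * ∑ i, k (ω i) :=
      calc 4 * R * M * p₀ * s = 8 * R * s * (M * p₀ / 2) := by ring
        _ ≤ 8 * R * s * ∑ i, k (ω i) := mul_le_mul_of_nonneg_left hk.le hRs.le
    exact abs_le.2 ⟨by linarith, by linarith⟩
  have htotal := (measureReal_mono hcover).trans <| (measureReal_union_le _ _).trans <|
    add_le_add_right ((measureReal_union_le _ _).trans <|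
      add_le_add_right (measureReal_union_le _ _) _) ((Measure.pi fun _ : Fin M => P).real good)
  rw [probReal_univ] at htotal
  linarith

/-- Theorem 1 of the paper, with general Hölder constant `L`:
finite-sample bound for the functional Nadaraya–Watson estimator. -/
theorem nadaraya_watson_finite_sample_bound
    {𝒳 : Type*} [MeasurableSpace 𝒳]
    (ρ : 𝒳 → 𝒳 → ℝ)
    (hρ_meas : Measurable fun p : 𝒳 × 𝒳 => ρ p.1 p.2)
    (hρ_nonneg : ∀ u v, 0 ≤ ρ u v)
    (hρ_symm : ∀ u v, ρ u v = ρ v u)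
    (hρ_refl : ∀ u, ρ u u = 0)
    (hρ_tri : ∀ u v w, ρ u w ≤ ρ u v + ρ v w)
    (P : Measure (𝒳 × ℝ)) [IsProbabilityMeasure P]
    (R : ℝ) (hR : 0 < R)
    (hY : ∀ᵐ p ∂P, |p.2| ≤ R)
    (F : 𝒳 → ℝ) (hF_meas : Measurable F) (hF_bdd : ∀ z, |F z| ≤ R)
    (hF_reg : ∀ g : 𝒳 → ℝ, Measurable g → (∃ Cg : ℝ, ∀ z, |g z| ≤ Cg) →
      ∫ p, p.2 * g p.1 ∂P = ∫ z, F z * g z ∂(P.map Prod.fst))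
    (K : ℝ → ℝ) (hK_meas : Measurable K) (hK_nonneg : ∀ u, 0 ≤ K u)
    (b B : ℝ) (hb : 0 < b) (hbB : b ≤ B)
    (hK_bounds : ∀ u : ℝ, 0 ≤ u →
      (Set.Icc (0:ℝ) 1).indicator (fun _ => b) u ≤ K u ∧
      K u ≤ (Set.Icc (0:ℝ) 1).indicator (fun _ => B) u)
    (β L : ℝ) (hβ : β ∈ Set.Ioc (0:ℝ) 1) (hL : 0 < L)
    (hHolder : ∀ u v, |F u - F v| ≤ L * ρ u v ^ β)
    (x : 𝒳) (h : ℝ) (hh : 0 < h)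
    (φ : ℝ) (hφ_def : φ = ((P.map Prod.fst) {z | ρ z x ≤ h}).toReal)
    (hφ_pos : 0 < φ)
    (δ : ℝ) (hδ : δ ∈ Set.Ioo (0:ℝ) 1)
    (M : ℕ) (hM : 16 * B * Real.log (6 / δ) / (b * φ) ≤ (M : ℝ)) :
    (Measure.pi fun _ : Fin M => P)
      {ω | |(∑ i, (ω i).2 * K (h⁻¹ * ρ x (ω i).1)) /
              (∑ j, K (h⁻¹ * ρ x (ω j).1)) - F x|
          ≤ L * (B / b) * h ^ β
            + 8 * R * Real.sqrt (2 * B * Real.log (6 / δ) / (b * φ * M))}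
      ≥ ENNReal.ofReal (1 - δ) := by
  have hB : 0 < B := hb.trans_le hbB
  have hρx_meas : Measurable fun z => ρ x z := hρ_meas.comp measurable_prodMk_left
  set k : 𝒳 → ℝ := fun z => K (h⁻¹ * ρ x z)
  have hk_meas : Measurable k := hK_meas.comp (hρx_meas.const_mul _)
  have hk_nonneg : ∀ z, 0 ≤ k z := fun z => hK_nonneg _
  have harg : ∀ z, 0 ≤ h⁻¹ * ρ x z := fun z => mul_nonneg (by positivity) (hρ_nonneg _ _)
  have hk_le : ∀ z, k z ≤ B := fun z => by
    refine (hK_bounds _ (harg z)).2.trans ?_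
    exact Set.indicator_le_self' (fun _ _ => hB.le) _
  have hk_near : ∀ z, ρ x z ≤ h → b ≤ k z := fun z hz => by
    have hmem : h⁻¹ * ρ x z ∈ Set.Icc (0:ℝ) 1 :=
      ⟨harg z, by rwa [inv_mul_le_iff₀ hh, mul_one]⟩
    simpa only [Set.indicator_of_mem hmem] using (hK_bounds _ (harg z)).1
  have hk_far : ∀ z, h < ρ x z → k z = 0 := fun z hz => by
    have hmem : h⁻¹ * ρ x z ∉ Set.Icc (0:ℝ) 1 := fun hmem => by
      have := hmem.2
      rw [inv_mul_le_iff₀ hh, mul_one] at this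
      exact hz.not_ge this
    refine le_antisymm ?_ (hk_nonneg z)
    simpa only [Set.indicator_of_notMem hmem] using (hK_bounds _ (harg z)).2
  have hk_abs : ∀ z, |k z| ≤ B := fun z => by
    rw [abs_of_nonneg (hk_nonneg z)]
    exact hk_le z
  set Q := P.map Prod.fst
  have : IsProbabilityMeasure Q := Measure.isProbabilityMeasure_map measurable_fst.aemeasurable
  have hk_int : Integrable k Q := .of_bound hk_meas.aestronglyMeasurable B (.of_forall hk_abs)
  have hFk_int : Integrable (fun z => F z * k z) Q :=
    hk_int.bdd_mul hF_meas.aestronglyMeasurable (.of_forall hF_bdd)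
  have hk_map : ∫ p : 𝒳 × ℝ, k p.1 ∂P = ∫ z, k z ∂Q :=
    (integral_map measurable_fst.aemeasurable hk_meas.aestronglyMeasurable).symm
  set p₀ := ∫ z, k z ∂Q with hp₀_def
  have hp₀_ge : b * φ ≤ p₀ := by
    have hS : MeasurableSet {z | ρ z x ≤ h} := by
      simp only [hρ_symm _ x]
      exact measurableSet_le hρx_meas measurable_const
    have hφ_int : b * φ = ∫ z, {z | ρ z x ≤ h}.indicator (fun _ => b) z ∂Q := by
      rw [integral_indicator_const b hS, hφ_def, smul_eq_mul, mul_comm]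
      rfl
    rw [hφ_int]
    refine integral_mono ((integrable_const b).indicator hS) hk_int fun z => ?_
    refine Set.indicator_le' (fun z hz => hk_near z ?_) (fun z _ => hk_nonneg z) z
    rw [hρ_symm]
    exact hz
  have hp₀ : 0 < p₀ := (by positivity : 0 < b * φ).trans_le hp₀_ge
  set c := (∫ z, F z * k z ∂Q) / p₀ with hc_def
  have hc_mul : c * p₀ = ∫ z, F z * k z ∂Q := div_mul_cancel₀ _ hp₀.ne'
  have hc : |c| ≤ R := by
    rw [hc_def, abs_div, abs_of_pos hp₀, div_le_iff₀ hp₀, hp₀_def, ← integral_const_mul,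
      ← Real.norm_eq_abs]
    refine norm_integral_le_of_norm_le (hk_int.const_mul R) (.of_forall fun z => ?_)
    rw [Real.norm_eq_abs, abs_mul, abs_of_nonneg (hk_nonneg z)]
    exact mul_le_mul_of_nonneg_right (hF_bdd z) (hk_nonneg z)
  have hbias : |c - F x| ≤ L * (B / b) * h ^ β := by
    have hmul : (c - F x) * p₀ = ∫ z, (F z - F x) * k z ∂Q := by
      simp only [sub_mul]
      rw [integral_sub hFk_int (hk_int.const_mul _), integral_const_mul, hc_mul]
    have hle : |(c - F x) * p₀| ≤ L * h ^ β * p₀ := by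
      rw [hmul, hp₀_def, ← integral_const_mul, ← Real.norm_eq_abs]
      refine norm_integral_le_of_norm_le (hk_int.const_mul _) (.of_forall fun z => ?_)
      rw [Real.norm_eq_abs, abs_mul, abs_of_nonneg (hk_nonneg z)]
      rcases le_or_gt (ρ x z) h with hz | hz
      · refine mul_le_mul_of_nonneg_right ((hHolder z x).trans ?_) (hk_nonneg z)
        rw [hρ_symm]
        exact mul_le_mul_of_nonneg_left
          (Real.rpow_le_rpow (hρ_nonneg _ _) hz hβ.1.le) hL.le
      · simp [hk_far z hz]
    rw [abs_mul, abs_of_pos hp₀] at hle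
    have hL_le : L * h ^ β ≤ L * (B / b) * h ^ β :=
      mul_le_mul_of_nonneg_right (le_mul_of_one_le_right hL.le ((one_le_div hb).2 hbB))
        (Real.rpow_nonneg hh.le β)
    exact (le_of_mul_le_mul_right hle hp₀).trans hL_le
  have hcenter : ∫ p : 𝒳 × ℝ, (p.2 - c) * k p.1 ∂P = 0 := by
    have hk_int' : Integrable (fun p : 𝒳 × ℝ => k p.1) P := hk_int.comp_measurable measurable_fst
    simp only [sub_mul]
    rw [integral_sub (hk_int'.bdd_mul measurable_snd.aestronglyMeasurable hY)
      (hk_int'.const_mul c), integral_const_mul, hF_reg k hk_meas ⟨B, hk_abs⟩, hk_map, hc_mul,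
      sub_self]
  have hmain := measureReal_pi_weighted_average_ge P (Y := Prod.snd) (k := fun p => k p.1)
    measurable_snd (hk_meas.comp measurable_fst) hR hB (by positivity : 0 < b * φ) hδ hY
    (fun p => hk_nonneg _) (fun p => hk_le _) hc hcenter (by rwa [hk_map]) hM
  refine (ENNReal.ofReal_le_iff_le_toReal (measure_ne_top _ _)).2 (hmain.trans ?_)
  refine measureReal_mono fun ω hω => ?_
  simp only [Set.mem_ofPred_eq] at hω ⊢
  exact (abs_sub_le _ c _).trans (by linarith)
end

section
/- Fix x ∈ 𝒳, h > 0 with φ_x(h) > 0, and δ ∈ (0,1). Then with probability at least 1 − δ/3 over the i.i.d. sample, the relative deviation of the empirical kernel density satisfies |p_h(x) − p_M(x)|/p_h(x) ≤ √(2·B·log(6/δ)/(b·φ_x(h)·M)) + 2·B·log(6/δ)/(b·φ_x(h)·M). -/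
open MeasureTheory

/-- Quadratic upper bound for `exp` on the negative half-line. -/
lemma Real.exp_neg_le_quadratic {x : ℝ} (hx : 0 ≤ x) :
    Real.exp (-x) ≤ 1 - x + x ^ 2 / 2 := by
  have h := Real.quadratic_le_exp_of_nonneg hx
  have hpos : 0 < 1 - x + x ^ 2 / 2 := by nlinarith [sq_nonneg (x - 1)]
  rw [Real.exp_neg, inv_le_iff_one_le_mul₀ (Real.exp_pos x)]
  nlinarith [mul_le_mul_of_nonneg_left h hpos.le, sq_nonneg (x ^ 2)]

/-- Lower bound for the Bennett rate function. -/
lemma Real.sq_div_two_add_le_bennett {x : ℝ} (hx : 0 ≤ x) :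
    x ^ 2 / (2 + x) ≤ (1 + x) * Real.log (1 + x) - x := by
  have h := mul_le_mul_of_nonneg_left (Real.le_log_one_add_of_nonneg hx)
    (by positivity : 0 ≤ 1 + x)
  have heq : x ^ 2 / (2 + x) = (1 + x) * (2 * x / (x + 2)) - x := by
    field_simp
    ring
  linarith

/-- The chord bound for the exponential on `[0, B]`. -/
lemma Real.exp_mul_le_chord {B y : ℝ} (hB : 0 < B) (hy : y ∈ Set.Icc 0 B) (t : ℝ) :
    Real.exp (t * y) ≤ 1 + y * ((Real.exp (t * B) - 1) / B) := by
  have h := convexOn_exp.2 (Set.mem_univ 0) (Set.mem_univ (t * B))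
    (sub_nonneg.2 ((div_le_one hB).2 hy.2)) (div_nonneg hy.1 hB.le) (by ring)
  simp only [smul_eq_mul, mul_zero, zero_add, Real.exp_zero, mul_one] at h
  calc Real.exp (t * y) = Real.exp (y / B * (t * B)) := by congr 1; field_simp
    _ ≤ _ := h
    _ = _ := by ring

namespace ProbabilityTheory

variable {Ω : Type*} [MeasurableSpace Ω] {P : Measure Ω} [IsProbabilityMeasure P]
  {f : Ω → ℝ} {B : ℝ}

/-- The moment generating function of a `[0, B]`-valued variable is at most that of a rescaled
Poisson variable with the same mean. -/
lemma mgf_le_exp_of_mem_Icc (hf : Measurable f) (hB : 0 < B) (hfB : ∀ z, f z ∈ Set.Icc 0 B)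
    (t : ℝ) :
    mgf f P t ≤ Real.exp ((∫ z, f z ∂P) * ((Real.exp (t * B) - 1) / B)) := by
  have hint : Integrable f P := .of_mem_Icc 0 B hf.aemeasurable (.of_forall hfB)
  calc mgf f P t ≤ ∫ z, 1 + f z * ((Real.exp (t * B) - 1) / B) ∂P :=
        integral_mono (integrable_exp_mul_of_mem_Icc hf.aemeasurable (.of_forall hfB))
          ((integrable_const _).add (hint.mul_const _))
          fun z => Real.exp_mul_le_chord hB (hfB z) t
    _ = (∫ z, f z ∂P) * ((Real.exp (t * B) - 1) / B) + 1 := by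
        rw [integral_add (integrable_const _) (hint.mul_const _), integral_mul_const]
        simp [add_comm]
    _ ≤ _ := Real.add_one_le_exp _

variable {M : ℕ}

lemma integrable_exp_mul_sum_pi (hf : Measurable f) (hfB : ∀ z, f z ∈ Set.Icc 0 B) (t : ℝ) :
    Integrable (fun ω : Fin M → Ω => Real.exp (t * ∑ j, f (ω j)))
      (Measure.pi fun _ : Fin M => P) := by
  refine integrable_exp_mul_of_mem_Icc (a := 0) (b := ∑ _j : Fin M, B)
    (Measurable.aemeasurable (by fun_prop)) (.of_forall fun ω => ?_)
  exact ⟨Finset.sum_nonneg fun j _ => (hfB _).1, Finset.sum_le_sum fun j _ => (hfB _).2⟩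

lemma mgf_sum_pi_le (hf : Measurable f) (hB : 0 < B) (hfB : ∀ z, f z ∈ Set.Icc 0 B) (t : ℝ) :
    mgf (fun ω : Fin M → Ω => ∑ j, f (ω j)) (Measure.pi fun _ : Fin M => P) t
      ≤ Real.exp (M * (∫ z, f z ∂P) / B * (Real.exp (t * B) - 1)) := by
  have hind : iIndepFun (fun (j : Fin M) (ω : Fin M → Ω) => f (ω j))
      (Measure.pi fun _ : Fin M => P) := iIndepFun_pi fun _ => hf.aemeasurable
  have hsum := hind.mgf_sum (t := t) (fun j => by fun_prop) Finset.univ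
  have heval (j : Fin M) :
      mgf (fun ω : Fin M → Ω => f (ω j)) (Measure.pi fun _ : Fin M => P) t = mgf f P t :=
    integral_comp_eval (μ := fun _ : Fin M => P) (i := j)
      (f := fun z => Real.exp (t * f z)) (by fun_prop)
  have hfun : (fun ω : Fin M → Ω => ∑ j, f (ω j))
      = ∑ j, fun ω : Fin M → Ω => f (ω j) := by
    ext ω
    simp
  rw [hfun, hsum]
  simp only [heval, Finset.prod_const, Finset.card_univ, Fintype.card_fin]
  calc mgf f P t ^ M
      ≤ Real.exp ((∫ z, f z ∂P) * ((Real.exp (t * B) - 1) / B)) ^ M :=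
        pow_le_pow_left₀ mgf_nonneg (mgf_le_exp_of_mem_Icc hf hB hfB t) M
    _ = _ := by
        rw [← Real.exp_nat_mul]
        congr 1
        ring

/-- Multiplicative Chernoff bound, upper tail. -/
lemma measure_sum_pi_ge_le (hf : Measurable f) (hB : 0 < B) (hfB : ∀ z, f z ∈ Set.Icc 0 B)
    {ε : ℝ} (hε : 0 ≤ ε) :
    (Measure.pi fun _ : Fin M => P).real
        {ω | M * (∫ z, f z ∂P) * (1 + ε) ≤ ∑ j, f (ω j)}
      ≤ Real.exp (-(M * (∫ z, f z ∂P) / B * (ε ^ 2 / (2 + ε)))) := by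
  have hp : 0 ≤ ∫ z, f z ∂P := integral_nonneg fun z => (hfB z).1
  have ht : 0 ≤ Real.log (1 + ε) / B := div_nonneg (Real.log_nonneg (by linarith)) hB.le
  refine (measure_ge_le_exp_mul_mgf _ ht (integrable_exp_mul_sum_pi hf hfB _)).trans ?_
  refine (mul_le_mul_of_nonneg_left (mgf_sum_pi_le hf hB hfB _) (Real.exp_pos _).le).trans ?_
  rw [← Real.exp_add, Real.exp_le_exp, div_mul_cancel₀ _ hB.ne', Real.exp_log (by linarith)]
  have h := mul_le_mul_of_nonneg_left (Real.sq_div_two_add_le_bennett hε)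
    (by positivity : 0 ≤ M * (∫ z, f z ∂P) / B)
  calc _ = -(M * (∫ z, f z ∂P) / B * ((1 + ε) * Real.log (1 + ε) - ε)) := by ring
    _ ≤ _ := neg_le_neg h

/-- Multiplicative Chernoff bound, lower tail. -/
lemma measure_sum_pi_le_le (hf : Measurable f) (hB : 0 < B) (hfB : ∀ z, f z ∈ Set.Icc 0 B)
    {ε : ℝ} (hε : 0 ≤ ε) :
    (Measure.pi fun _ : Fin M => P).real
        {ω | ∑ j, f (ω j) ≤ M * (∫ z, f z ∂P) * (1 - ε)}
      ≤ Real.exp (-(M * (∫ z, f z ∂P) / B * (ε ^ 2 / 2))) := by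
  have hp : 0 ≤ ∫ z, f z ∂P := integral_nonneg fun z => (hfB z).1
  have ht : -ε / B ≤ 0 := div_nonpos_of_nonpos_of_nonneg (by linarith) hB.le
  refine (measure_le_le_exp_mul_mgf _ ht (integrable_exp_mul_sum_pi hf hfB _)).trans ?_
  refine (mul_le_mul_of_nonneg_left (mgf_sum_pi_le hf hB hfB _) (Real.exp_pos _).le).trans ?_
  rw [← Real.exp_add, Real.exp_le_exp, div_mul_cancel₀ _ hB.ne']
  have h := mul_le_mul_of_nonneg_left (Real.exp_neg_le_quadratic hε)
    (by positivity : 0 ≤ M * (∫ z, f z ∂P) / B)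
  calc _ = M * (∫ z, f z ∂P) / B * Real.exp (-ε)
        - M * (∫ z, f z ∂P) / B * (1 - ε + ε ^ 2) := by ring
    _ ≤ M * (∫ z, f z ∂P) / B * (1 - ε + ε ^ 2 / 2)
        - M * (∫ z, f z ∂P) / B * (1 - ε + ε ^ 2) := by gcongr
    _ = _ := by ring

/-- Relative Bernstein bound for the empirical mean of a `[0, B]`-valued function. -/
lemma measure_relative_deviation_gt_le (hf : Measurable f) (hB : 0 < B)
    (hfB : ∀ z, f z ∈ Set.Icc 0 B) (hp : 0 < ∫ z, f z ∂P) (hM : 0 < M)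
    {a L : ℝ} (ha : 0 ≤ a) (hL : L ≤ M * (∫ z, f z ∂P) / B * a) :
    (Measure.pi fun _ : Fin M => P).real
        {ω | |(∫ z, f z ∂P) - (M : ℝ)⁻¹ * ∑ j, f (ω j)| / (∫ z, f z ∂P)
          ≤ Real.sqrt (2 * a) + 2 * a}ᶜ
      ≤ 2 * Real.exp (-L) := by
  set p := ∫ z, f z ∂P with hp_def
  set ε := Real.sqrt (2 * a) + 2 * a with hε_def
  have hs : 0 ≤ Real.sqrt (2 * a) := Real.sqrt_nonneg _
  have hs2 : Real.sqrt (2 * a) ^ 2 = 2 * a := Real.sq_sqrt (by positivity)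
  have hε : 0 ≤ ε := by positivity
  have hM' : (0 : ℝ) < M := by exact_mod_cast hM
  have hlow : a ≤ ε ^ 2 / 2 := by nlinarith [mul_nonneg hs ha]
  have hup : a ≤ ε ^ 2 / (2 + ε) := by
    rw [le_div_iff₀ (by positivity)]
    nlinarith [mul_nonneg hs ha]
  have hq : 0 ≤ M * p / B := by positivity
  have hsub : {ω : Fin M → Ω | |p - (M : ℝ)⁻¹ * ∑ j, f (ω j)| / p ≤ ε}ᶜ
      ⊆ {ω | M * p * (1 + ε) ≤ ∑ j, f (ω j)} ∪ {ω | ∑ j, f (ω j) ≤ M * p * (1 - ε)} := by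
    intro ω hω
    simp only [Set.mem_compl_iff, Set.mem_ofPred_eq, not_le, lt_div_iff₀ hp, lt_abs] at hω
    have hS : ∑ j, f (ω j) = M * ((M : ℝ)⁻¹ * ∑ j, f (ω j)) := by field_simp
    rcases hω with hω | hω
    · right
      rw [Set.mem_ofPred_eq, hS, mul_assoc]
      exact mul_le_mul_of_nonneg_left (by linarith) hM'.le
    · left
      rw [Set.mem_ofPred_eq, hS, mul_assoc]
      exact mul_le_mul_of_nonneg_left (by linarith) hM'.le
  have h1 := measure_sum_pi_ge_le (P := P) (M := M) hf hB hfB hε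
  have h2 := measure_sum_pi_le_le (P := P) (M := M) hf hB hfB hε
  rw [← hp_def] at h1 h2
  have e1 : Real.exp (-(M * p / B * (ε ^ 2 / (2 + ε)))) ≤ Real.exp (-L) :=
    Real.exp_le_exp.2 (neg_le_neg (hL.trans (mul_le_mul_of_nonneg_left hup hq)))
  have e2 : Real.exp (-(M * p / B * (ε ^ 2 / 2))) ≤ Real.exp (-L) :=
    Real.exp_le_exp.2 (neg_le_neg (hL.trans (mul_le_mul_of_nonneg_left hlow hq)))
  have h3 := (measureReal_mono (μ := Measure.pi fun _ : Fin M => P) hsub).trans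
    (measureReal_union_le _ _)
  linarith

end ProbabilityTheory

/-- Bernstein bound on the relative deviation of the empirical
kernel density `p_M(x)` from `p_h(x)`. -/
theorem empirical_density_deviation_bound
    {𝒳 : Type*} [MeasurableSpace 𝒳]
    (ρ : 𝒳 → 𝒳 → ℝ)
    (hρ_meas : Measurable fun p : 𝒳 × 𝒳 => ρ p.1 p.2)
    (hρ_nonneg : ∀ u v, 0 ≤ ρ u v)
    (hρ_symm : ∀ u v, ρ u v = ρ v u)
    (hρ_refl : ∀ u, ρ u u = 0)
    (hρ_tri : ∀ u v w, ρ u w ≤ ρ u v + ρ v w)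
    (P_X : Measure 𝒳) [IsProbabilityMeasure P_X]
    (K : ℝ → ℝ) (hK_meas : Measurable K) (hK_nonneg : ∀ u, 0 ≤ K u)
    (b B : ℝ) (hb : 0 < b) (hbB : b ≤ B)
    (hK_bounds : ∀ u : ℝ, 0 ≤ u →
      (Set.Icc (0:ℝ) 1).indicator (fun _ => b) u ≤ K u ∧
      K u ≤ (Set.Icc (0:ℝ) 1).indicator (fun _ => B) u)
    (x : 𝒳) (h : ℝ) (hh : 0 < h)
    (φ : ℝ) (hφ_def : φ = (P_X {z | ρ z x ≤ h}).toReal) (hφ_pos : 0 < φ)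
    (δ : ℝ) (hδ : δ ∈ Set.Ioo (0:ℝ) 1)
    (M : ℕ) (hM : 0 < M) :
    (Measure.pi fun _ : Fin M => P_X)
      {ω | |(∫ z, K (h⁻¹ * ρ x z) ∂P_X) - (M : ℝ)⁻¹ * ∑ j, K (h⁻¹ * ρ x (ω j))| /
             (∫ z, K (h⁻¹ * ρ x z) ∂P_X)
          ≤ Real.sqrt (2 * B * Real.log (6 / δ) / (b * φ * M))
            + 2 * B * Real.log (6 / δ) / (b * φ * M)}
      ≥ ENNReal.ofReal (1 - δ / 3) := by
  obtain ⟨hδ0, hδ1⟩ := hδ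
  have hB : 0 < B := hb.trans_le hbB
  have hM' : (0 : ℝ) < M := by exact_mod_cast hM
  have hρx : Measurable fun z => ρ x z := hρ_meas.comp measurable_prodMk_left
  have hu (z : 𝒳) : 0 ≤ h⁻¹ * ρ x z := mul_nonneg (inv_nonneg.2 hh.le) (hρ_nonneg x z)
  have hf : Measurable fun z => K (h⁻¹ * ρ x z) := hK_meas.comp (hρx.const_mul _)
  have hfB (z : 𝒳) : K (h⁻¹ * ρ x z) ∈ Set.Icc 0 B :=
    ⟨hK_nonneg _, (hK_bounds _ (hu z)).2.trans
      (Set.indicator_le_self' (fun _ _ => hB.le) _)⟩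
  have hball : MeasurableSet {z | ρ z x ≤ h} := by
    simp only [hρ_symm _ x]
    exact measurableSet_le hρx measurable_const
  have hp : b * φ ≤ ∫ z, K (h⁻¹ * ρ x z) ∂P_X := by
    have hind : ∫ z, {z | ρ z x ≤ h}.indicator (fun _ => b) z ∂P_X = b * φ := by
      rw [integral_indicator_const _ hball, hφ_def, smul_eq_mul, mul_comm, Measure.real]
    rw [← hind]
    refine integral_mono ((integrable_const b).indicator hball)
      (.of_mem_Icc 0 B hf.aemeasurable (.of_forall hfB)) ?_
    refine Set.indicator_le' (fun z hz => ?_) fun z _ => hK_nonneg _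
    have hz' : h⁻¹ * ρ x z ∈ Set.Icc (0 : ℝ) 1 := by
      refine ⟨hu z, ?_⟩
      rw [inv_mul_le_iff₀ hh, mul_one, hρ_symm]
      exact hz
    simpa [Set.indicator_of_mem hz'] using (hK_bounds _ (hu z)).1
  have hbφ : 0 < b * φ := mul_pos hb hφ_pos
  have hL0 : 0 ≤ Real.log (6 / δ) :=
    Real.log_nonneg (by rw [le_div_iff₀ hδ0]; linarith)
  have hL : Real.log (6 / δ) ≤ M * (∫ z, K (h⁻¹ * ρ x z) ∂P_X) / B
      * (B * Real.log (6 / δ) / (b * φ * M)) := by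
    have heq : M * (∫ z, K (h⁻¹ * ρ x z) ∂P_X) / B * (B * Real.log (6 / δ) / (b * φ * M))
        = (∫ z, K (h⁻¹ * ρ x z) ∂P_X) / (b * φ) * Real.log (6 / δ) := by
      field_simp
    rw [heq]
    exact le_mul_of_one_le_left hL0 ((one_le_div hbφ).2 hp)
  have key := ProbabilityTheory.measure_relative_deviation_gt_le hf hB hfB
    (hbφ.trans_le hp) hM (by positivity) hL
  have hexp : 2 * Real.exp (-Real.log (6 / δ)) = δ / 3 := by
    rw [Real.exp_neg, Real.exp_log (by positivity)]
    field_simp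
    norm_num
  have harg : 2 * (B * Real.log (6 / δ) / (b * φ * M))
      = 2 * B * Real.log (6 / δ) / (b * φ * M) := by ring
  rw [hexp, harg] at key
  refine ENNReal.ofReal_le_of_le_toReal ?_
  change _ ≤ (Measure.pi fun _ : Fin M => P_X).real _
  have huniv (s : Set (Fin M → 𝒳)) : 1 ≤ (Measure.pi fun _ : Fin M => P_X).real s
      + (Measure.pi fun _ : Fin M => P_X).real sᶜ := by
    simpa using measureReal_union_le (μ := Measure.pi fun _ : Fin M => P_X) s sᶜ
  exact (sub_le_sub_left key 1).trans (sub_le_iff_le_add.2 (huniv _))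
end

section
/- Fix x ∈ 𝒳, h > 0 with φ_x(h) > 0, and δ ∈ (0,1). If the sample size satisfies M ≥ 16·B·log(6/δ)/(b·φ_x(h)), then with probability at least 1 − δ/3 over the i.i.d. sample, |p_h(x) − p_M(x)|/p_h(x) ≤ 1/2. -/
open MeasureTheory

/-- A function with values in `[0, B]` satisfies a Bennett-type bound on its exponential moment. -/
theorem integral_exp_mul_le_of_mem_Icc {Ω : Type*} [MeasurableSpace Ω] (P : Measure Ω)
    [IsProbabilityMeasure P] {g : Ω → ℝ} (hg : Measurable g) {B s : ℝ}
    (hgB : ∀ z, g z ∈ Set.Icc 0 B) (hs : |s| * B ≤ 1) :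
    ∫ z, Real.exp (s * g z) ∂P ≤ Real.exp ((s + s ^ 2 * B) * ∫ z, g z ∂P) := by
  have hg_int : Integrable g P := Integrable.of_mem_Icc 0 B hg.aemeasurable (ae_of_all _ hgB)
  have pointwise (z : Ω) : Real.exp (s * g z) ≤ 1 + (s + s ^ 2 * B) * g z := by
    obtain ⟨h0, h1⟩ := hgB z
    have habs : |s * g z| ≤ 1 := by
      rw [abs_mul, abs_of_nonneg h0]
      exact (mul_le_mul_of_nonneg_left h1 (abs_nonneg s)).trans hs
    have hexp := (abs_le.mp (Real.abs_exp_sub_one_sub_id_le habs)).2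
    nlinarith [mul_le_mul_of_nonneg_left (mul_le_mul_of_nonneg_right h1 h0) (sq_nonneg s)]
  calc ∫ z, Real.exp (s * g z) ∂P
      ≤ ∫ z, (1 + (s + s ^ 2 * B) * g z) ∂P :=
        integral_mono (ProbabilityTheory.integrable_exp_mul_of_mem_Icc hg.aemeasurable
          (ae_of_all _ hgB)) ((integrable_const _).add (hg_int.const_mul _)) pointwise
    _ = (s + s ^ 2 * B) * ∫ z, g z ∂P + 1 := by
        rw [integral_add (integrable_const _) (hg_int.const_mul _), integral_const_mul]
        simp [add_comm]
    _ ≤ _ := Real.add_one_le_exp _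

/-- Chernoff bound for an i.i.d. sum of functions with values in `[0, B]`; the sign of `s` selects
the upper or the lower tail. -/
theorem measureReal_pi_le_mul_sum_le {Ω : Type*} [MeasurableSpace Ω] (P : Measure Ω)
    [IsProbabilityMeasure P] {g : Ω → ℝ} (hg : Measurable g) {B s : ℝ}
    (hgB : ∀ z, g z ∈ Set.Icc 0 B) (hs : |s| * B ≤ 1) (M : ℕ) (a : ℝ) :
    (Measure.pi fun _ : Fin M => P).real {ω | a ≤ s * ∑ j, g (ω j)}
      ≤ Real.exp (-a + M * ((s + s ^ 2 * B) * ∫ z, g z ∂P)) := by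
  have hprod (ω : Fin M → Ω) :
      Real.exp (1 * (s * ∑ j, g (ω j))) = ∏ j, Real.exp (s * g (ω j)) := by
    rw [one_mul, Finset.mul_sum, Real.exp_sum]
  have hint : Integrable (fun ω : Fin M → Ω => Real.exp (1 * (s * ∑ j, g (ω j))))
      (Measure.pi fun _ => P) := by
    simp_rw [hprod]
    exact Integrable.fintype_prod fun _ =>
      ProbabilityTheory.integrable_exp_mul_of_mem_Icc hg.aemeasurable (ae_of_all _ hgB)
  refine (ProbabilityTheory.measure_ge_le_exp_mul_mgf a zero_le_one hint).trans ?_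
  rw [ProbabilityTheory.mgf, Real.exp_add, neg_one_mul]
  simp_rw [hprod]
  rw [integral_fintype_prod_eq_pow (ι := Fin M) (fun z => Real.exp (s * g z)), Fintype.card_fin,
    Real.exp_nat_mul]
  gcongr
  exact integral_exp_mul_le_of_mem_Icc P hg hgB hs

/-- Two-sided multiplicative Chernoff bound with relative error one half. -/
theorem measureReal_pi_half_lt_relative_deviation_le {Ω : Type*} [MeasurableSpace Ω]
    (P : Measure Ω) [IsProbabilityMeasure P] {g : Ω → ℝ} (hg : Measurable g) {B : ℝ} (hB : 0 < B)
    (hgB : ∀ z, g z ∈ Set.Icc 0 B) (hp : 0 < ∫ z, g z ∂P) {M : ℕ} (hM : 0 < M) :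
    (Measure.pi fun _ : Fin M => P).real
      {ω | 1 / 2 < |(∫ z, g z ∂P) - (M : ℝ)⁻¹ * ∑ j, g (ω j)| / ∫ z, g z ∂P}
      ≤ 2 * Real.exp (-(M * (∫ z, g z ∂P) / (16 * B))) := by
  set p := ∫ z, g z ∂P with hp_def
  have hM' : (0 : ℝ) < M := by exact_mod_cast hM
  have hs : |(4 * B)⁻¹| * B ≤ 1 := by
    rw [abs_of_pos (by positivity)]
    field_simp
    norm_num
  have upper := measureReal_pi_le_mul_sum_le P hg hgB hs M ((4 * B)⁻¹ * (3 / 2 * (M * p)))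
  have lower := measureReal_pi_le_mul_sum_le P hg hgB (s := -(4 * B)⁻¹) (by rwa [abs_neg]) M
    (-(4 * B)⁻¹ * (1 / 2 * (M * p)))
  rw [← hp_def] at upper lower
  have upper_exponent : -((4 * B)⁻¹ * (3 / 2 * (M * p)))
      + M * (((4 * B)⁻¹ + (4 * B)⁻¹ ^ 2 * B) * p) = -(M * p / (16 * B)) := by
    field_simp
    ring
  have lower_exponent : -(-(4 * B)⁻¹ * (1 / 2 * (M * p)))
      + M * ((-(4 * B)⁻¹ + (-(4 * B)⁻¹) ^ 2 * B) * p) = -(M * p / (16 * B)) := by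
    field_simp
    ring
  rw [upper_exponent] at upper
  rw [lower_exponent] at lower
  rw [two_mul]
  refine (measureReal_mono ?_).trans ((measureReal_union_le _ _).trans (add_le_add upper lower))
  intro ω hω
  simp only [Set.mem_ofPred_eq, Set.mem_union] at hω ⊢
  rw [lt_div_iff₀ hp, lt_abs] at hω
  have hsum : ∑ j, g (ω j) = M * ((M : ℝ)⁻¹ * ∑ j, g (ω j)) := by field_simp
  rw [hsum]
  generalize (M : ℝ)⁻¹ * ∑ j, g (ω j) = q at hω
  rcases hω with hω | hω
  · right
    rw [neg_mul, neg_mul, neg_le_neg_iff]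
    refine mul_le_mul_of_nonneg_left ?_ (by positivity)
    nlinarith
  · left
    refine mul_le_mul_of_nonneg_left ?_ (by positivity)
    nlinarith

/-- if `M ≥ 16·B·log(6/δ)/(b·φ_x(h))`, then with probability at
least `1 − δ/3` the relative deviation `|p_h(x) − p_M(x)|/p_h(x)` is at most `1/2`. -/
theorem empirical_density_relative_deviation_half
    {𝒳 : Type*} [MeasurableSpace 𝒳]
    (ρ : 𝒳 → 𝒳 → ℝ)
    (hρ_meas : Measurable fun p : 𝒳 × 𝒳 => ρ p.1 p.2)
    (hρ_nonneg : ∀ u v, 0 ≤ ρ u v)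
    (hρ_symm : ∀ u v, ρ u v = ρ v u)
    (hρ_refl : ∀ u, ρ u u = 0)
    (hρ_tri : ∀ u v w, ρ u w ≤ ρ u v + ρ v w)
    (P_X : Measure 𝒳) [IsProbabilityMeasure P_X]
    (K : ℝ → ℝ) (hK_meas : Measurable K) (hK_nonneg : ∀ u, 0 ≤ K u)
    (b B : ℝ) (hb : 0 < b) (hbB : b ≤ B)
    (hK_bounds : ∀ u : ℝ, 0 ≤ u →
      (Set.Icc (0:ℝ) 1).indicator (fun _ => b) u ≤ K u ∧
      K u ≤ (Set.Icc (0:ℝ) 1).indicator (fun _ => B) u)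
    (x : 𝒳) (h : ℝ) (hh : 0 < h)
    (φ : ℝ) (hφ_def : φ = (P_X {z | ρ z x ≤ h}).toReal) (hφ_pos : 0 < φ)
    (δ : ℝ) (hδ : δ ∈ Set.Ioo (0:ℝ) 1)
    (M : ℕ) (hM : 16 * B * Real.log (6 / δ) / (b * φ) ≤ (M : ℝ)) :
    (Measure.pi fun _ : Fin M => P_X)
      {ω | |(∫ z, K (h⁻¹ * ρ x z) ∂P_X) - (M : ℝ)⁻¹ * ∑ j, K (h⁻¹ * ρ x (ω j))| /
             (∫ z, K (h⁻¹ * ρ x z) ∂P_X) ≤ 1 / 2}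
      ≥ ENNReal.ofReal (1 - δ / 3) := by
  have hB : 0 < B := hb.trans_le hbB
  have hρx : Measurable fun z => ρ x z := hρ_meas.comp (measurable_const.prodMk measurable_id)
  set g : 𝒳 → ℝ := fun z => K (h⁻¹ * ρ x z)
  have hg : Measurable g := hK_meas.comp (hρx.const_mul _)
  have hu (z : 𝒳) : 0 ≤ h⁻¹ * ρ x z := mul_nonneg (inv_nonneg.mpr hh.le) (hρ_nonneg x z)
  have hgB (z : 𝒳) : g z ∈ Set.Icc 0 B :=
    ⟨hK_nonneg _, (hK_bounds _ (hu z)).2.trans (Set.indicator_le_self' (fun _ _ => hB.le) _)⟩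
  have hball : MeasurableSet {z | ρ z x ≤ h} := by
    simp_rw [hρ_symm _ x]
    exact measurableSet_le hρx measurable_const
  have hp_ge : b * φ ≤ ∫ z, g z ∂P_X := by
    calc b * φ = ∫ z, {z | ρ z x ≤ h}.indicator (fun _ => b) z ∂P_X := by
          rw [integral_indicator_const _ hball, hφ_def, Measure.real, smul_eq_mul, mul_comm]
      _ ≤ _ := by
          refine integral_mono ((integrable_const b).indicator hball)
            (Integrable.of_mem_Icc 0 B hg.aemeasurable (ae_of_all _ hgB))
            (Set.indicator_le' (fun z hz => ?_) fun z _ => hK_nonneg _)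
          have hz' : h⁻¹ * ρ x z ≤ 1 := by
            rw [inv_mul_le_iff₀ hh, mul_one, hρ_symm]
            exact hz
          simpa [hu z, hz'] using (hK_bounds _ (hu z)).1
  have hp : 0 < ∫ z, g z ∂P_X := (mul_pos hb hφ_pos).trans_le hp_ge
  have hlog : 0 < Real.log (6 / δ) :=
    Real.log_pos ((one_lt_div hδ.1).mpr (by linarith [hδ.2]))
  have hM_pos : 0 < M := by
    have : (0 : ℝ) < M := lt_of_lt_of_le (by positivity) hM
    exact_mod_cast this
  have hexponent : Real.log (6 / δ) ≤ M * (∫ z, g z ∂P_X) / (16 * B) := by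
    rw [le_div_iff₀ (by positivity)]
    rw [div_le_iff₀ (by positivity)] at hM
    linarith [mul_le_mul_of_nonneg_left hp_ge (Nat.cast_nonneg (α := ℝ) M)]
  have htail : 2 * Real.exp (-(M * (∫ z, g z ∂P_X) / (16 * B))) ≤ δ / 3 := by
    have hδ6 : Real.exp (-Real.log (6 / δ)) = δ / 6 := by
      rw [Real.exp_neg, Real.exp_log (div_pos (by norm_num) hδ.1), inv_div]
    linarith [Real.exp_le_exp.mpr (neg_le_neg hexponent)]
  have hbad := (measureReal_pi_half_lt_relative_deviation_le P_X hg hB hgB hp hM_pos).trans htail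
  have hgood : MeasurableSet {ω : Fin M → 𝒳 |
      |(∫ z, g z ∂P_X) - (M : ℝ)⁻¹ * ∑ j, g (ω j)| / (∫ z, g z ∂P_X) ≤ 1 / 2} := by
    refine measurableSet_le ?_ measurable_const
    fun_prop
  have hcompl := probReal_compl_eq_one_sub (μ := Measure.pi fun _ : Fin M => P_X) hgood
  simp only [Set.compl_ofPred, not_le] at hcompl
  refine ENNReal.ofReal_le_of_le_toReal ?_
  rw [← Measure.real]
  linarith
end

section
/- Fix x ∈ 𝒳, h > 0 with φ_x(h) > 0, and δ ∈ (0,1). Then with probability at least 1 − δ/3 over the i.i.d. sample, |M⁻¹ Σ_{i=1}^M Y⁽ⁱ⁾·K(h⁻¹ρ(x,X⁽ⁱ⁾))/p_h(x) − F_h(x)| ≤ R·√(2·B·log(6/δ)/(b·φ_x(h)·M)) + 2·R·B·log(6/δ)/(b·φ_x(h)·M). -/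
open MeasureTheory

/-- Second-order upper bound for the exponential on `[-a, a]` with `a < 1`. -/
lemma Real.exp_le_one_add_add_sq_div {z a : ℝ} (hz : |z| ≤ a) (ha : a < 1) :
    Real.exp z ≤ 1 + z + z ^ 2 / (2 * (1 - a)) := by
  have hbound := (abs_le.mp (Real.exp_bound (x := z) (hz.trans ha.le) (n := 3) (by norm_num))).2
  norm_num [Finset.sum_range_succ, Nat.factorial] at hbound
  have ha0 : 0 ≤ a := (abs_nonneg z).trans hz
  have hcube : |z| ^ 3 ≤ z ^ 2 * a := by
    rw [pow_succ, sq_abs]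
    exact mul_le_mul_of_nonneg_left hz (sq_nonneg z)
  have hgeom : z ^ 2 / 2 * (1 + a) ≤ z ^ 2 / (2 * (1 - a)) := by
    rw [le_div_iff₀ (by linarith)]
    nlinarith [mul_nonneg (sq_nonneg z) (sq_nonneg a)]
  nlinarith [mul_nonneg (sq_nonneg z) ha0]

section Bernstein

variable {α : Type*} [MeasurableSpace α] {P : Measure α} [IsProbabilityMeasure P]
  {f : α → ℝ} {c v : ℝ}

/-- Bernstein's bound on the moment generating function of a bounded random variable. -/
lemma integral_exp_mul_le_of_abs_le (hf : Measurable f) (hfc : ∀ᵐ p ∂P, |f p| ≤ c)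
    (hv : ∫ p, f p ^ 2 ∂P ≤ v) {l : ℝ} (hl : 0 ≤ l) (hlc : l * c < 1) :
    ∫ p, Real.exp (l * f p) ∂P
      ≤ Real.exp (l * ∫ p, f p ∂P + l ^ 2 * v / (2 * (1 - l * c))) := by
  have hint : Integrable f P := Integrable.of_bound hf.aestronglyMeasurable c hfc
  have hint2 : Integrable (fun p => f p ^ 2) P := by
    refine Integrable.of_bound (hf.pow_const 2).aestronglyMeasurable (c ^ 2) ?_
    filter_upwards [hfc] with p hp
    rw [Real.norm_eq_abs, abs_pow]
    exact pow_le_pow_left₀ (abs_nonneg _) hp 2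
  have hint_lin : Integrable (fun p => 1 + l * f p) P :=
    (integrable_const 1).add (hint.const_mul l)
  have hint_sq : Integrable (fun p => l ^ 2 / (2 * (1 - l * c)) * f p ^ 2) P :=
    hint2.const_mul _
  have hmono : ∫ p, Real.exp (l * f p) ∂P
      ≤ ∫ p, (1 + l * f p + l ^ 2 / (2 * (1 - l * c)) * f p ^ 2) ∂P := by
    refine integral_mono_of_nonneg (.of_forall fun p => (Real.exp_pos _).le)
      (hint_lin.add hint_sq) ?_
    filter_upwards [hfc] with p hp
    have hz : |l * f p| ≤ l * c := by
      rw [abs_mul, abs_of_nonneg hl]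
      exact mul_le_mul_of_nonneg_left hp hl
    refine (Real.exp_le_one_add_add_sq_div hz hlc).trans (le_of_eq ?_)
    ring
  have heq : ∫ p, (1 + l * f p + l ^ 2 / (2 * (1 - l * c)) * f p ^ 2) ∂P
      = 1 + l * ∫ p, f p ∂P + l ^ 2 / (2 * (1 - l * c)) * ∫ p, f p ^ 2 ∂P := by
    rw [integral_add hint_lin hint_sq, integral_add (integrable_const 1) (hint.const_mul l),
      integral_const_mul, integral_const_mul]
    simp
  have hcoef : 0 ≤ l ^ 2 / (2 * (1 - l * c)) := div_nonneg (sq_nonneg l) (by linarith)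
  have hvar := mul_le_mul_of_nonneg_left hv hcoef
  have hexp := Real.add_one_le_exp (l * ∫ p, f p ∂P + l ^ 2 * v / (2 * (1 - l * c)))
  have hcomm : l ^ 2 / (2 * (1 - l * c)) * v = l ^ 2 * v / (2 * (1 - l * c)) := by ring
  linarith

/-- One-sided Bernstein inequality for the sum of an i.i.d. sample. -/
lemma bernstein_upper_tail (hf : Measurable f) (hc : 0 ≤ c) (hfc : ∀ᵐ p ∂P, |f p| ≤ c)
    (hv0 : 0 < v) (hv : ∫ p, f p ^ 2 ∂P ≤ v) {L : ℝ} (hL : 0 ≤ L) {M : ℕ} (hM : 0 < M) :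
    (Measure.pi fun _ : Fin M => P).real
        {ω | M * (∫ p, f p ∂P + (√(2 * v * L / M) + c * L / M)) ≤ ∑ i, f (ω i)}
      ≤ Real.exp (-L) := by
  have hM' : (0 : ℝ) < M := by exact_mod_cast hM
  set s := √(2 * v * L / M)
  have hs0 : 0 ≤ s := Real.sqrt_nonneg _
  have hs2 : s ^ 2 = 2 * v * L / M := Real.sq_sqrt (by positivity)
  have hd : 0 < v + c * s := by positivity
  set l := s / (v + c * s) with hl_def
  have hl : 0 ≤ l := div_nonneg hs0 hd.le
  have hlc' : 1 - l * c = v / (v + c * s) := by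
    rw [hl_def]; field_simp; ring
  have hlc : l * c < 1 := by
    have : 0 < v / (v + c * s) := div_pos hv0 hd
    linarith
  set m := ∫ p, f p ∂P
  have hmgf := integral_exp_mul_le_of_abs_le hf hfc hv hl hlc
  have hprod (ω : Fin M → α) :
      Real.exp (l * ∑ i, f (ω i)) = ∏ i, Real.exp (l * f (ω i)) := by
    rw [Finset.mul_sum, Real.exp_sum]
  have hexp_int : Integrable (fun p => Real.exp (l * f p)) P := by
    refine Integrable.of_bound (hf.const_mul l).exp.aestronglyMeasurable (Real.exp (l * c)) ?_
    filter_upwards [hfc] with p hp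
    rw [Real.norm_eq_abs, abs_of_pos (Real.exp_pos _), Real.exp_le_exp]
    exact mul_le_mul_of_nonneg_left (le_of_abs_le hp) hl
  have hsum_int : Integrable (fun ω : Fin M → α => Real.exp (l * ∑ i, f (ω i)))
      (Measure.pi fun _ : Fin M => P) := by
    simp_rw [hprod]
    exact Integrable.fintype_prod (f := fun _ p => Real.exp (l * f p)) fun _ => hexp_int
  refine (ProbabilityTheory.measure_ge_le_exp_mul_mgf _ hl hsum_int).trans ?_
  have hmgf_sum : ProbabilityTheory.mgf (fun ω : Fin M → α => ∑ i, f (ω i))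
      (Measure.pi fun _ : Fin M => P) l = (∫ p, Real.exp (l * f p) ∂P) ^ M := by
    simp only [ProbabilityTheory.mgf, hprod]
    rw [integral_fintype_prod_eq_prod (fun _ p => Real.exp (l * f p))]
    simp
  have hpow := pow_le_pow_left₀ (integral_nonneg fun p => (Real.exp_pos _).le) hmgf M
  rw [← Real.exp_nat_mul] at hpow
  rw [hmgf_sum]
  refine (mul_le_mul_of_nonneg_left hpow (Real.exp_pos _).le).trans ?_
  rw [← Real.exp_add, Real.exp_le_exp]
  refine le_of_eq ?_
  have hLs : L = s ^ 2 * M / (2 * v) := by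
    rw [hs2]; field_simp
  rw [hlc', hl_def, hLs]
  field_simp
  ring

/-- Two-sided Bernstein inequality for the empirical mean of an i.i.d. sample. -/
lemma bernstein_empirical_mean (hf : Measurable f) (hc : 0 ≤ c) (hfc : ∀ᵐ p ∂P, |f p| ≤ c)
    (hv0 : 0 < v) (hv : ∫ p, f p ^ 2 ∂P ≤ v) {L : ℝ} (hL : 0 ≤ L) {M : ℕ} (hM : 0 < M) :
    (Measure.pi fun _ : Fin M => P)
        {ω | |(M : ℝ)⁻¹ * ∑ i, f (ω i) - ∫ p, f p ∂P| ≤ √(2 * v * L / M) + c * L / M}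
      ≥ ENNReal.ofReal (1 - 2 * Real.exp (-L)) := by
  have hM' : (0 : ℝ) < M := by exact_mod_cast hM
  have hup := bernstein_upper_tail hf hc hfc hv0 hv hL hM
  have hlow := bernstein_upper_tail (P := P) (f := fun p => -f p) hf.neg hc (by simpa using hfc)
    hv0 (by simpa using hv) hL hM
  set t := √(2 * v * L / M) + c * L / M
  set m := ∫ p, f p ∂P with hm
  rw [integral_neg, ← hm] at hlow
  set S := {ω : Fin M → α | |(M : ℝ)⁻¹ * ∑ i, f (ω i) - m| ≤ t}
  have hsum : Measurable fun ω : Fin M → α => ∑ i, f (ω i) :=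
    Finset.measurable_sum _ fun i _ => hf.comp (measurable_pi_apply i)
  have hS : MeasurableSet S :=
    measurableSet_le (continuous_abs.measurable.comp ((hsum.const_mul _).sub_const m))
      measurable_const
  have hsub : Sᶜ ⊆ {ω | M * (m + t) ≤ ∑ i, f (ω i)} ∪
      {ω | M * (-m + t) ≤ ∑ i, -f (ω i)} := by
    intro ω hω
    have hω' : t < |(M : ℝ)⁻¹ * ∑ i, f (ω i) - m| := not_le.mp hω
    have hcancel : (M : ℝ) * ((M : ℝ)⁻¹ * ∑ i, f (ω i)) = ∑ i, f (ω i) :=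
      mul_inv_cancel_left₀ hM'.ne' _
    rcases lt_abs.mp hω' with h | h
    · left
      have := mul_le_mul_of_nonneg_left h.le hM'.le
      simp only [Set.mem_ofPred_eq]
      linarith
    · right
      have := mul_le_mul_of_nonneg_left h.le hM'.le
      simp only [Set.mem_ofPred_eq, Finset.sum_neg_distrib]
      linarith
  have hcompl := (measureReal_mono (μ := Measure.pi fun _ : Fin M => P) hsub).trans
    (measureReal_union_le _ _)
  rw [probReal_compl_eq_one_sub hS] at hcompl
  refine ENNReal.ofReal_le_of_le_toReal ?_
  change _ ≤ (Measure.pi fun _ : Fin M => P).real S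
  linarith

end Bernstein

/-- Bernstein bound for the normalized empirical numerator around
the smoothed regression function `F_h(x)`. -/
theorem empirical_numerator_deviation_bound
    {𝒳 : Type*} [MeasurableSpace 𝒳]
    (ρ : 𝒳 → 𝒳 → ℝ)
    (hρ_meas : Measurable fun p : 𝒳 × 𝒳 => ρ p.1 p.2)
    (hρ_nonneg : ∀ u v, 0 ≤ ρ u v)
    (hρ_symm : ∀ u v, ρ u v = ρ v u)
    (hρ_refl : ∀ u, ρ u u = 0)
    (hρ_tri : ∀ u v w, ρ u w ≤ ρ u v + ρ v w)
    (P : Measure (𝒳 × ℝ)) [IsProbabilityMeasure P]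
    (R : ℝ) (hR : 0 < R)
    (hY : ∀ᵐ p ∂P, |p.2| ≤ R)
    (K : ℝ → ℝ) (hK_meas : Measurable K) (hK_nonneg : ∀ u, 0 ≤ K u)
    (b B : ℝ) (hb : 0 < b) (hbB : b ≤ B)
    (hK_bounds : ∀ u : ℝ, 0 ≤ u →
      (Set.Icc (0:ℝ) 1).indicator (fun _ => b) u ≤ K u ∧
      K u ≤ (Set.Icc (0:ℝ) 1).indicator (fun _ => B) u)
    (x : 𝒳) (h : ℝ) (hh : 0 < h)
    (φ : ℝ) (hφ_def : φ = ((P.map Prod.fst) {z | ρ z x ≤ h}).toReal)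
    (hφ_pos : 0 < φ)
    (δ : ℝ) (hδ : δ ∈ Set.Ioo (0:ℝ) 1)
    (M : ℕ) (hM : 0 < M) :
    (Measure.pi fun _ : Fin M => P)
      {ω | |((M : ℝ)⁻¹ * ∑ i, (ω i).2 * K (h⁻¹ * ρ x (ω i).1)) /
              (∫ z, K (h⁻¹ * ρ x z) ∂(P.map Prod.fst))
            - (∫ z, K (h⁻¹ * ρ x z) ∂(P.map Prod.fst))⁻¹ *
                (∫ p, p.2 * K (h⁻¹ * ρ x p.1) ∂P)|
          ≤ R * Real.sqrt (2 * B * Real.log (6 / δ) / (b * φ * M))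
            + 2 * R * B * Real.log (6 / δ) / (b * φ * M)}
      ≥ ENNReal.ofReal (1 - δ / 3) := by
  have hρx : Measurable fun z => ρ x z := hρ_meas.comp measurable_prodMk_left
  have hk : Measurable fun z => K (h⁻¹ * ρ x z) := hK_meas.comp (hρx.const_mul _)
  have hB : 0 < B := hb.trans_le hbB
  have hKB (u : ℝ) (hu : 0 ≤ u) : K u ≤ B :=
    (hK_bounds u hu).2.trans (Set.indicator_le_self' (fun _ _ => hB.le) u)
  have harg (z : 𝒳) : 0 ≤ h⁻¹ * ρ x z := mul_nonneg (inv_nonneg.mpr hh.le) (hρ_nonneg x z)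
  have : IsProbabilityMeasure (P.map Prod.fst) :=
    Measure.isProbabilityMeasure_map measurable_fst.aemeasurable
  set p := ∫ z, K (h⁻¹ * ρ x z) ∂(P.map Prod.fst)
  have hk_int : Integrable (fun z => K (h⁻¹ * ρ x z)) (P.map Prod.fst) :=
    Integrable.of_bound hk.aestronglyMeasurable B (.of_forall fun z => by
      rw [Real.norm_eq_abs, abs_of_nonneg (hK_nonneg _)]
      exact hKB _ (harg z))
  have hp_lower : b * φ ≤ p := by
    have hball : MeasurableSet {z | ρ z x ≤ h} :=
      measurableSet_le (hρ_meas.comp measurable_prodMk_right) measurable_const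
    have hind : ∫ z, {z | ρ z x ≤ h}.indicator (fun _ => b) z ∂(P.map Prod.fst) = b * φ := by
      rw [integral_indicator_const _ hball, hφ_def, smul_eq_mul, mul_comm]
      rfl
    rw [← hind]
    refine integral_mono ((integrable_const b).indicator hball) hk_int fun z => ?_
    by_cases hz : ρ z x ≤ h
    · have hmem : h⁻¹ * ρ x z ∈ Set.Icc (0 : ℝ) 1 := by
        refine ⟨harg z, ?_⟩
        rw [hρ_symm, inv_mul_le_iff₀ hh, mul_one]
        exact hz
      have hlow := (hK_bounds _ (harg z)).1
      rw [Set.indicator_of_mem hmem] at hlow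
      rw [Set.indicator_of_mem (show z ∈ {z | ρ z x ≤ h} from hz)]
      exact hlow
    · rw [Set.indicator_of_notMem (show z ∉ {z | ρ z x ≤ h} from hz)]
      exact hK_nonneg _
  have hbφ : 0 < b * φ := mul_pos hb hφ_pos
  have hp : 0 < p := hbφ.trans_le hp_lower
  have hp_eq : ∫ q, K (h⁻¹ * ρ x q.1) ∂P = p :=
    (integral_map measurable_fst.aemeasurable hk.aestronglyMeasurable).symm
  have hk_int' : Integrable (fun q : 𝒳 × ℝ => K (h⁻¹ * ρ x q.1)) P :=
    hk_int.comp_measurable measurable_fst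
  let f : 𝒳 × ℝ → ℝ := fun q => q.2 * K (h⁻¹ * ρ x q.1) / p
  have hf : Measurable f := (measurable_snd.mul (hk.comp measurable_fst)).div_const p
  have hfc : ∀ᵐ q ∂P, |f q| ≤ R * B / (b * φ) := by
    filter_upwards [hY] with q hq
    rw [abs_div, abs_mul, abs_of_pos hp, abs_of_nonneg (hK_nonneg _)]
    exact div_le_div₀ (by positivity)
      (mul_le_mul hq (hKB _ (harg _)) (hK_nonneg _) hR.le) hbφ hp_lower
  have hv : ∫ q, f q ^ 2 ∂P ≤ R ^ 2 * B / (b * φ) := by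
    have hmono : ∫ q, f q ^ 2 ∂P ≤ ∫ q, R ^ 2 * B / p ^ 2 * K (h⁻¹ * ρ x q.1) ∂P := by
      refine integral_mono_of_nonneg (.of_forall fun q => sq_nonneg _)
        (hk_int'.const_mul _) ?_
      filter_upwards [hY] with q hq
      have hq2 : q.2 ^ 2 ≤ R ^ 2 := by
        rw [← sq_abs]
        exact pow_le_pow_left₀ (abs_nonneg _) hq 2
      have hK2 : K (h⁻¹ * ρ x q.1) ^ 2 ≤ B * K (h⁻¹ * ρ x q.1) := by
        rw [sq]
        exact mul_le_mul_of_nonneg_right (hKB _ (harg _)) (hK_nonneg _)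
      calc f q ^ 2 = q.2 ^ 2 * K (h⁻¹ * ρ x q.1) ^ 2 / p ^ 2 := by
            simp only [f, div_pow, mul_pow]
        _ ≤ R ^ 2 * (B * K (h⁻¹ * ρ x q.1)) / p ^ 2 := by gcongr
        _ = R ^ 2 * B / p ^ 2 * K (h⁻¹ * ρ x q.1) := by ring
    rw [integral_const_mul, hp_eq] at hmono
    refine hmono.trans ?_
    calc R ^ 2 * B / p ^ 2 * p = R ^ 2 * B / p := by field_simp
      _ ≤ R ^ 2 * B / (b * φ) := by gcongr
  obtain ⟨hδ0, hδ1⟩ := hδ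
  have hL : 0 ≤ Real.log (6 / δ) := Real.log_nonneg (by rw [le_div_iff₀ hδ0]; linarith)
  have hexp : 1 - 2 * Real.exp (-Real.log (6 / δ)) = 1 - δ / 3 := by
    rw [Real.exp_neg, Real.exp_log (by positivity)]
    field_simp
    ring
  have hbern := bernstein_empirical_mean (P := P) hf (by positivity) hfc (by positivity) hv hL hM
  rw [hexp] at hbern
  refine hbern.trans (measure_mono fun ω hω => ?_)
  have hmean : (M : ℝ)⁻¹ * ∑ i, f (ω i)
      = ((M : ℝ)⁻¹ * ∑ i, (ω i).2 * K (h⁻¹ * ρ x (ω i).1)) / p := by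
    rw [mul_div_assoc, Finset.sum_div]
  have hint : ∫ q, f q ∂P = p⁻¹ * ∫ q, q.2 * K (h⁻¹ * ρ x q.1) ∂P := by
    rw [integral_div, div_eq_inv_mul]
  rw [Set.mem_ofPred_eq, hmean, hint] at hω
  refine hω.trans (add_le_add (le_of_eq ?_) ?_)
  · rw [show 2 * (R ^ 2 * B / (b * φ)) * Real.log (6 / δ) / M
        = R ^ 2 * (2 * B * Real.log (6 / δ) / (b * φ * M)) by field_simp,
      Real.sqrt_mul (sq_nonneg R), Real.sqrt_sq hR.le]
  · have hnonneg : 0 ≤ R * B * Real.log (6 / δ) / (b * φ * M) := by positivity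
    calc R * B / (b * φ) * Real.log (6 / δ) / M
        = R * B * Real.log (6 / δ) / (b * φ * M) := by field_simp
      _ ≤ 2 * (R * B * Real.log (6 / δ) / (b * φ * M)) := by linarith
      _ = 2 * R * B * Real.log (6 / δ) / (b * φ * M) := by ring
end

section
/- For any two continuously differentiable paths x, y : [0,T] → ℝ^d, the signature distance is controlled by the 1-variation distance: ρ^Sig(x,y) ≤ ‖x − y‖_{1-var} · (e^{‖y‖_{1-var}} + ‖x‖_{1-var} · e^{‖x‖_{1-var} + ‖y‖_{1-var}}). -/
open MeasureTheory

/-- Iterated integral for the word `[i_1, …, i_k]`; the head of the list is the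
*outermost* integration variable. -/
noncomputable def sigAux {ι : Type*} (x' : ℝ → ι → ℝ) : List ι → ℝ → ℝ
  | [], _ => 1
  | i :: w, t => ∫ s in (0:ℝ)..t, x' s i * sigAux x' w s

/-- Signature coefficient `Sig^w(x)` for the word `w = [i₁, …, i_k]`, expressed
through the derivative `x'` of the path. -/
noncomputable def sigCoeff {ι : Type*} (x' : ℝ → ι → ℝ) (T : ℝ) (w : List ι) : ℝ :=
  sigAux x' w.reverse T

/-- Signature distance `ρ^Sig(x,y) ∈ [0,∞]` of two paths, expressed through the
derivatives `x'`, `y'`. -/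
noncomputable def rhoSig {d : ℕ} (x' y' : ℝ → Fin d → ℝ) (T : ℝ) : ENNReal :=
  (∑' k : ℕ, ∑ w : Fin k → Fin d,
      ENNReal.ofReal ((sigCoeff x' T (List.ofFn w) - sigCoeff y' T (List.ofFn w)) ^ 2))
    ^ (1 / 2 : ℝ)

/-- 1-variation `‖x‖_{1-var} = ∫₀ᵀ |ẋ_t| dt` of a continuously differentiable path,
expressed through its derivative `x'` (Euclidean norm of the derivative). -/
noncomputable def oneVar {d : ℕ} (x' : ℝ → Fin d → ℝ) (T : ℝ) : ℝ :=
  ∫ t in (0:ℝ)..T, Real.sqrt (∑ i, (x' t i) ^ 2)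

/-- The Euclidean norm of a finite family of reals. -/
noncomputable def euclNorm {ι : Type*} [Fintype ι] (v : ι → ℝ) : ℝ :=
  Real.sqrt (∑ i, (v i) ^ 2)

section EuclNorm

variable {ι κ : Type*} [Fintype ι] [Fintype κ]

lemma euclNorm_eq_norm (v : ι → ℝ) : euclNorm v = ‖WithLp.toLp 2 v‖ := by
  simp [euclNorm, EuclideanSpace.norm_eq]

lemma euclNorm_nonneg (v : ι → ℝ) : 0 ≤ euclNorm v := Real.sqrt_nonneg _

lemma euclNorm_sq (v : ι → ℝ) : euclNorm v ^ 2 = ∑ i, (v i) ^ 2 :=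
  Real.sq_sqrt (Finset.sum_nonneg fun _ _ => sq_nonneg _)

lemma euclNorm_add_le (u v : ι → ℝ) : euclNorm (fun i => u i + v i) ≤ euclNorm u + euclNorm v := by
  simp only [euclNorm_eq_norm]
  exact norm_add_le (WithLp.toLp 2 u) (WithLp.toLp 2 v)

lemma euclNorm_tensor (u : ι → ℝ) (v : κ → ℝ) :
    euclNorm (fun p : ι × κ => u p.1 * v p.2) = euclNorm u * euclNorm v := by
  unfold euclNorm
  rw [← Real.sqrt_mul (Finset.sum_nonneg fun _ _ => sq_nonneg _), Fintype.sum_mul_sum,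
    Fintype.sum_prod_type]
  simp only [mul_pow]

lemma continuous_euclNorm {f : ℝ → ι → ℝ} (hf : ∀ i, Continuous fun t => f t i) :
    Continuous fun t => euclNorm (f t) := by
  unfold euclNorm
  fun_prop

/-- Minkowski's integral inequality for the Euclidean norm. -/
lemma euclNorm_integral_le {f : ℝ → ι → ℝ} (hf : ∀ i, Continuous fun t => f t i)
    {t : ℝ} (ht : 0 ≤ t) :
    euclNorm (fun i => ∫ s in (0:ℝ)..t, f s i) ≤ ∫ s in (0:ℝ)..t, euclNorm (f s) := by
  have hF : Continuous fun s => (WithLp.toLp 2 (f s) : EuclideanSpace ℝ ι) :=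
    (PiLp.continuous_toLp 2 _).comp (continuous_pi hf)
  have h : (WithLp.toLp 2 (fun i => ∫ s in (0:ℝ)..t, f s i) : EuclideanSpace ℝ ι)
      = ∫ s in (0:ℝ)..t, (WithLp.toLp 2 (f s) : EuclideanSpace ℝ ι) := by
    ext i
    exact (EuclideanSpace.proj (𝕜 := ℝ) i).intervalIntegral_comp_comm
      (hF.intervalIntegrable 0 t)
  simp only [euclNorm_eq_norm]
  rw [h]
  exact intervalIntegral.norm_integral_le_integral_norm ht

end EuclNorm

lemma HasDerivAt.pow_succ_div_factorial {f : ℝ → ℝ} {f' t : ℝ} (hf : HasDerivAt f f' t) (k : ℕ) :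
    HasDerivAt (fun s => f s ^ (k + 1) / ((k + 1).factorial : ℝ))
      (f' * (f t ^ k / k.factorial)) t := by
  refine ((hf.fun_pow (k + 1)).div_const ((k + 1).factorial : ℝ)).congr_deriv ?_
  rw [Nat.factorial_succ]
  push_cast
  have := Nat.factorial_pos k
  field_simp

section Signature

variable {d : ℕ}

lemma continuous_sigAux {x' : ℝ → Fin d → ℝ} (hx : ∀ i, Continuous fun t => x' t i)
    (w : List (Fin d)) : Continuous (sigAux x' w) := by
  induction w with
  | nil => exact continuous_const
  | cons i w ih =>
    exact intervalIntegral.continuous_primitive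
      (fun a b => ((hx i).mul ih).intervalIntegrable a b) 0

lemma sigAux_congr {x' y' : ℝ → Fin d → ℝ} {T : ℝ}
    (h : ∀ t ∈ Set.Icc (0:ℝ) T, x' t = y' t) (w : List (Fin d)) :
    ∀ t ∈ Set.Icc (0:ℝ) T, sigAux x' w t = sigAux y' w t := by
  induction w with
  | nil => intro t _; rfl
  | cons i w ih =>
    intro t ht
    refine intervalIntegral.integral_congr fun s hs => ?_
    rw [Set.uIcc_of_le ht.1] at hs
    have hs' : s ∈ Set.Icc (0:ℝ) T := ⟨hs.1, hs.2.trans ht.2⟩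
    simp only [h s hs', ih s hs']

lemma oneVar_congr {x' y' : ℝ → Fin d → ℝ} {T : ℝ} (hT : 0 ≤ T)
    (h : ∀ t ∈ Set.Icc (0:ℝ) T, x' t = y' t) : oneVar x' T = oneVar y' T := by
  refine intervalIntegral.integral_congr fun s hs => ?_
  rw [Set.uIcc_of_le hT] at hs
  simp only [h s hs]

lemma hasDerivAt_oneVar {x' : ℝ → Fin d → ℝ} (hx : ∀ i, Continuous fun t => x' t i) (t : ℝ) :
    HasDerivAt (oneVar x') (euclNorm (x' t)) t :=
  have h := continuous_euclNorm hx
  intervalIntegral.integral_hasDerivAt_right (h.intervalIntegrable 0 t)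
    (h.stronglyMeasurableAtFilter _ _) h.continuousAt

lemma continuous_oneVar {x' : ℝ → Fin d → ℝ} (hx : ∀ i, Continuous fun t => x' t i) :
    Continuous (oneVar x') :=
  continuous_iff_continuousAt.2 fun t => (hasDerivAt_oneVar hx t).continuousAt

lemma oneVar_nonneg (x' : ℝ → Fin d → ℝ) {t : ℝ} (ht : 0 ≤ t) : 0 ≤ oneVar x' t :=
  intervalIntegral.integral_nonneg ht fun _ _ => Real.sqrt_nonneg _

lemma oneVar_zero (x' : ℝ → Fin d → ℝ) : oneVar x' 0 = 0 :=
  intervalIntegral.integral_same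

/-- The level-`k` component of the (reversed) signature over `[0, t]`. -/
noncomputable def sigLevel (x' : ℝ → Fin d → ℝ) (k : ℕ) (t : ℝ) (w : Fin k → Fin d) : ℝ :=
  sigAux x' (List.ofFn w) t

lemma continuous_sigLevel {x' : ℝ → Fin d → ℝ} (hx : ∀ i, Continuous fun t => x' t i)
    (k : ℕ) (w : Fin k → Fin d) : Continuous fun t => sigLevel x' k t w :=
  continuous_sigAux hx _

lemma sigLevel_cons (x' : ℝ → Fin d → ℝ) (k : ℕ) (t : ℝ) (i : Fin d) (w : Fin k → Fin d) :
    sigLevel x' (k + 1) t (Fin.cons i w) = ∫ s in (0:ℝ)..t, x' s i * sigLevel x' k s w := by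
  simp only [sigLevel, List.ofFn_cons, sigAux]

lemma euclNorm_succ (k : ℕ) (f : (Fin (k + 1) → Fin d) → ℝ) :
    euclNorm f = euclNorm fun p : Fin d × (Fin k → Fin d) => f (Fin.cons p.1 p.2) := by
  unfold euclNorm
  rw [← (Fin.consEquiv fun _ : Fin (k + 1) => Fin d).sum_comp]
  rfl

lemma euclNorm_sigLevel_le {x' : ℝ → Fin d → ℝ} (hx : ∀ i, Continuous fun t => x' t i) (k : ℕ) :
    ∀ t, 0 ≤ t → euclNorm (sigLevel x' k t) ≤ oneVar x' t ^ k / k.factorial := by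
  induction k with
  | zero => intro t _; simp [euclNorm, sigLevel, sigAux]
  | succ k ih =>
    intro t ht
    have hN := continuous_euclNorm hx
    have hL := continuous_euclNorm (continuous_sigLevel hx k)
    have hV := continuous_oneVar hx
    rw [euclNorm_succ]
    simp only [sigLevel_cons]
    refine (euclNorm_integral_le (f := fun s (p : Fin d × (Fin k → Fin d)) =>
      x' s p.1 * sigLevel x' k s p.2)
      (fun p => (hx p.1).mul (continuous_sigLevel hx k p.2)) ht).trans ?_
    simp only [euclNorm_tensor]
    have hd := fun s => (hasDerivAt_oneVar hx s).pow_succ_div_factorial k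
    have hI := intervalIntegral.integral_eq_sub_of_hasDerivAt (a := 0) (b := t)
      (fun s _ => hd s) (Continuous.intervalIntegrable (by fun_prop) _ _)
    simp only [oneVar_zero, ne_eq, Nat.add_eq_zero_iff, one_ne_zero, and_false,
      not_false_eq_true, zero_pow, zero_div, sub_zero] at hI
    rw [← hI]
    refine intervalIntegral.integral_mono_on ht
      (Continuous.intervalIntegrable (by fun_prop) _ _)
      (Continuous.intervalIntegrable (by fun_prop) _ _) fun s hs => ?_
    exact mul_le_mul_of_nonneg_left (ih s hs.1) (euclNorm_nonneg _)

lemma euclNorm_sigLevel_sub_succ_le {x' y' : ℝ → Fin d → ℝ}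
    (hx : ∀ i, Continuous fun t => x' t i) (hy : ∀ i, Continuous fun t => y' t i) (k : ℕ)
    {t : ℝ} (ht : 0 ≤ t) :
    euclNorm (fun w => sigLevel x' (k + 1) t w - sigLevel y' (k + 1) t w) ≤
      ∫ s in (0:ℝ)..t, (euclNorm (fun i => x' s i - y' s i) * euclNorm (sigLevel y' k s) +
        euclNorm (x' s) * euclNorm (fun w => sigLevel x' k s w - sigLevel y' k s w)) := by
  have hSx := continuous_sigLevel hx k
  have hSy := continuous_sigLevel hy k
  have hN := continuous_euclNorm hx
  have hE := continuous_euclNorm fun i => (hx i).sub (hy i)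
  have hLy := continuous_euclNorm hSy
  have hD := continuous_euclNorm fun w => (hSx w).sub (hSy w)
  have hf : ∀ p : Fin d × (Fin k → Fin d), Continuous fun s =>
      (x' s p.1 - y' s p.1) * sigLevel y' k s p.2 +
        x' s p.1 * (sigLevel x' k s p.2 - sigLevel y' k s p.2) := fun p =>
    (((hx p.1).sub (hy p.1)).mul (hSy p.2)).add ((hx p.1).mul ((hSx p.2).sub (hSy p.2)))
  have hsub : ∀ p : Fin d × (Fin k → Fin d),
      sigLevel x' (k + 1) t (Fin.cons p.1 p.2) - sigLevel y' (k + 1) t (Fin.cons p.1 p.2) =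
      ∫ s in (0:ℝ)..t, ((x' s p.1 - y' s p.1) * sigLevel y' k s p.2 +
        x' s p.1 * (sigLevel x' k s p.2 - sigLevel y' k s p.2)) := by
    intro p
    have hIx := ((hx p.1).fun_mul (hSx p.2)).intervalIntegrable (μ := volume) 0 t
    have hIy := ((hy p.1).fun_mul (hSy p.2)).intervalIntegrable (μ := volume) 0 t
    rw [sigLevel_cons, sigLevel_cons, ← intervalIntegral.integral_sub hIx hIy]
    congr 1 with s
    ring
  rw [euclNorm_succ]
  simp only [hsub]
  refine (euclNorm_integral_le hf ht).trans ?_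
  refine intervalIntegral.integral_mono_on ht
    ((continuous_euclNorm hf).intervalIntegrable _ _)
    (((hE.mul hLy).add (hN.mul hD)).intervalIntegrable _ _) fun s _ => ?_
  refine (euclNorm_add_le _ _).trans_eq ?_
  rw [← euclNorm_tensor, ← euclNorm_tensor]

lemma euclNorm_sigLevel_sub_le {x' y' : ℝ → Fin d → ℝ}
    (hx : ∀ i, Continuous fun t => x' t i) (hy : ∀ i, Continuous fun t => y' t i) (k : ℕ) :
    ∀ t, 0 ≤ t → euclNorm (fun w => sigLevel x' (k + 1) t w - sigLevel y' (k + 1) t w) ≤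
      oneVar (fun t i => x' t i - y' t i) t *
        ((oneVar x' t + oneVar y' t) ^ k / k.factorial) := by
  have hxy : ∀ i, Continuous fun t => x' t i - y' t i := fun i => (hx i).sub (hy i)
  induction k with
  | zero =>
    intro t ht
    refine (euclNorm_sigLevel_sub_succ_le hx hy 0 ht).trans_eq ?_
    simp [euclNorm, sigLevel, sigAux, oneVar]
  | succ k ih =>
    intro t ht
    refine (euclNorm_sigLevel_sub_succ_le hx hy (k + 1) ht).trans ?_
    have hNx := continuous_euclNorm hx
    have hNy := continuous_euclNorm hy
    have hNE := continuous_euclNorm hxy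
    have hLy := continuous_euclNorm (continuous_sigLevel hy (k + 1))
    have hD := continuous_euclNorm fun w =>
      (continuous_sigLevel hx (k + 1) w).sub (continuous_sigLevel hy (k + 1) w)
    have hX := continuous_oneVar hx
    have hY := continuous_oneVar hy
    have hE := continuous_oneVar hxy
    have hd : ∀ s, HasDerivAt (fun s => oneVar (fun t i => x' t i - y' t i) s *
          ((oneVar x' s + oneVar y' s) ^ (k + 1) / ((k + 1).factorial : ℝ)))
        (euclNorm (fun i => x' s i - y' s i) *
            ((oneVar x' s + oneVar y' s) ^ (k + 1) / ((k + 1).factorial : ℝ)) +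
          (euclNorm (x' s) + euclNorm (y' s)) * (oneVar (fun t i => x' t i - y' t i) s *
            ((oneVar x' s + oneVar y' s) ^ k / k.factorial))) s := by
      intro s
      refine ((hasDerivAt_oneVar hxy s).fun_mul (((hasDerivAt_oneVar hx s).fun_add
        (hasDerivAt_oneVar hy s)).pow_succ_div_factorial k)).congr_deriv ?_
      ring
    have hI := intervalIntegral.integral_eq_sub_of_hasDerivAt (a := 0) (b := t)
      (fun s _ => hd s) (Continuous.intervalIntegrable (by fun_prop) _ _)
    simp only [oneVar_zero, zero_mul, sub_zero] at hI
    rw [← hI]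
    refine intervalIntegral.integral_mono_on ht
      (((hNE.mul hLy).add (hNx.mul hD)).intervalIntegrable _ _)
      (Continuous.intervalIntegrable (by fun_prop) _ _) fun s hs => ?_
    have hX0 := oneVar_nonneg x' hs.1
    have hY0 := oneVar_nonneg y' hs.1
    refine add_le_add (mul_le_mul_of_nonneg_left ?_ (euclNorm_nonneg _))
      (mul_le_mul ?_ (ih s hs.1) (euclNorm_nonneg _)
        (add_nonneg (euclNorm_nonneg _) (euclNorm_nonneg _)))
    · refine (euclNorm_sigLevel_le hy (k + 1) s hs.1).trans ?_
      gcongr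
      linarith
    · linarith [euclNorm_nonneg (y' s)]

lemma sum_sigCoeff_sub_sq (x' y' : ℝ → Fin d → ℝ) (T : ℝ) (k : ℕ) :
    ∑ w : Fin k → Fin d, ENNReal.ofReal
        ((sigCoeff x' T (List.ofFn w) - sigCoeff y' T (List.ofFn w)) ^ 2) =
      ENNReal.ofReal (euclNorm fun w => sigLevel x' k T w - sigLevel y' k T w) ^ 2 := by
  rw [← ENNReal.ofReal_pow (euclNorm_nonneg _), euclNorm_sq,
    ENNReal.ofReal_sum_of_nonneg fun _ _ => sq_nonneg _]
  refine Fintype.sum_equiv (Equiv.arrowCongr Fin.revPerm (Equiv.refl _)) _ _ fun w => ?_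
  have h : (List.ofFn w).reverse =
      List.ofFn (Equiv.arrowCongr Fin.revPerm (Equiv.refl (Fin d)) w) := by
    refine List.ext_getElem (by simp) fun n h₁ h₂ => ?_
    simp only [List.getElem_reverse, List.getElem_ofFn, Equiv.arrowCongr_apply, Equiv.coe_refl,
      Function.comp_apply, id_eq, Fin.revPerm_symm, Fin.revPerm_apply]
    congr 1
    ext
    simp
    omega
  simp only [sigCoeff, sigLevel, h]

end Signature

lemma ENNReal.tsum_sq_le_sq_tsum {α : Type*} (a : α → ENNReal) :
    ∑' k, a k ^ 2 ≤ (∑' k, a k) ^ 2 := by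
  rw [sq (∑' k, a k), ← ENNReal.tsum_mul_right]
  refine ENNReal.tsum_le_tsum fun k => ?_
  rw [sq]
  gcongr
  exact ENNReal.le_tsum k

lemma rhoSig_le_of_continuous {d : ℕ} {x' y' : ℝ → Fin d → ℝ}
    (hx : ∀ i, Continuous fun t => x' t i) (hy : ∀ i, Continuous fun t => y' t i)
    {T : ℝ} (hT : 0 ≤ T) :
    rhoSig x' y' T ≤ ENNReal.ofReal
      (oneVar (fun t i => x' t i - y' t i) T * Real.exp (oneVar x' T + oneVar y' T)) := by
  set E := oneVar (fun t i => x' t i - y' t i) T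
  set V := oneVar x' T + oneVar y' T
  have hE : 0 ≤ E := oneVar_nonneg _ hT
  have hV : 0 ≤ V := add_nonneg (oneVar_nonneg _ hT) (oneVar_nonneg _ hT)
  have hexp : HasSum (fun k : ℕ => E * (V ^ k / k.factorial)) (E * Real.exp V) := by
    refine HasSum.mul_left E ?_
    rw [Real.exp_eq_exp_ℝ]
    exact NormedSpace.expSeries_div_hasSum_exp V
  have hsum : ∑' k, ENNReal.ofReal (euclNorm fun w => sigLevel x' k T w - sigLevel y' k T w) ≤
      ENNReal.ofReal (E * Real.exp V) := by
    have h0 : (euclNorm fun w => sigLevel x' 0 T w - sigLevel y' 0 T w) = 0 := by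
      simp [euclNorm, sigLevel, sigAux]
    rw [tsum_eq_zero_add' ENNReal.summable, h0, ENNReal.ofReal_zero, zero_add, ← hexp.tsum_eq,
      ENNReal.ofReal_tsum_of_nonneg (fun k => by positivity) hexp.summable]
    exact ENNReal.tsum_le_tsum fun k =>
      ENNReal.ofReal_le_ofReal (euclNorm_sigLevel_sub_le hx hy k T hT)
  unfold rhoSig
  simp only [sum_sigCoeff_sub_sq]
  refine (ENNReal.rpow_le_rpow ((ENNReal.tsum_sq_le_sq_tsum _).trans
    (pow_le_pow_left' hsum 2)) (by norm_num)).trans_eq ?_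
  rw [← ENNReal.rpow_natCast, ← ENNReal.rpow_mul]
  norm_num

lemma exp_add_le_exp_add_mul_exp (a b : ℝ) :
    Real.exp (a + b) ≤ Real.exp b + a * Real.exp (a + b) := by
  have h := mul_le_mul_of_nonneg_right (Real.add_one_le_exp (-a)) (Real.exp_nonneg (a + b))
  rw [← Real.exp_add, neg_add_cancel_left] at h
  linarith

/-- the signature distance is controlled by the 1-variation distance:
`ρ^Sig(x,y) ≤ ‖x−y‖_{1-var}·(e^{‖y‖_{1-var}} + ‖x‖_{1-var}·e^{‖x‖_{1-var}+‖y‖_{1-var}})`. -/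
theorem signature_distance_le_one_variation
    (d : ℕ) (hd : 1 ≤ d) (T : ℝ) (hT : 0 < T)
    (x x' y y' : ℝ → Fin d → ℝ)
    (hxderiv : ∀ i : Fin d, ∀ t ∈ Set.Icc (0:ℝ) T,
      HasDerivAt (fun s => x s i) (x' t i) t)
    (hxcont : ∀ i : Fin d, ContinuousOn (fun t => x' t i) (Set.Icc (0:ℝ) T))
    (hyderiv : ∀ i : Fin d, ∀ t ∈ Set.Icc (0:ℝ) T,
      HasDerivAt (fun s => y s i) (y' t i) t)
    (hycont : ∀ i : Fin d, ContinuousOn (fun t => y' t i) (Set.Icc (0:ℝ) T)) :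
    rhoSig x' y' T
      ≤ ENNReal.ofReal
          (oneVar (fun t i => x' t i - y' t i) T *
            (Real.exp (oneVar y' T) +
              oneVar x' T * Real.exp (oneVar x' T + oneVar y' T))) := by
  -- Replace the derivatives by their continuous extensions, constant outside `[0, T]`.
  have key : ∀ z : ℝ → Fin d → ℝ, (∀ i, ContinuousOn (fun t => z t i) (Set.Icc (0:ℝ) T)) →
      ∃ u : ℝ → Fin d → ℝ, (∀ i, Continuous fun t => u t i) ∧
        ∀ t ∈ Set.Icc (0:ℝ) T, z t = u t := by
    intro z hz
    refine ⟨fun t => z (Set.projIcc 0 T hT.le t), fun i => ?_, fun t ht => ?_⟩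
    · exact (hz i).domRestrict.comp continuous_projIcc
    · simp only [Set.projIcc_of_mem hT.le ht]
  obtain ⟨u, hu, hxu⟩ := key x' hxcont
  obtain ⟨v, hv, hyv⟩ := key y' hycont
  have hTm : T ∈ Set.Icc (0:ℝ) T := ⟨hT.le, le_rfl⟩
  have hrho : rhoSig x' y' T = rhoSig u v T := by
    simp only [rhoSig, sigCoeff, sigAux_congr hxu _ T hTm, sigAux_congr hyv _ T hTm]
  have hdiff : oneVar (fun t i => x' t i - y' t i) T = oneVar (fun t i => u t i - v t i) T :=
    oneVar_congr hT.le fun t ht => by simp only [hxu t ht, hyv t ht]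
  rw [hrho, hdiff, oneVar_congr hT.le hxu, oneVar_congr hT.le hyv]
  refine (rhoSig_le_of_continuous hu hv hT.le).trans (ENNReal.ofReal_le_ofReal ?_)
  exact mul_le_mul_of_nonneg_left (exp_add_le_exp_add_mul_exp _ _) (oneVar_nonneg _ hT.le)
end

section
/- Let x, y : [0,T] → ℝ^d be continuously differentiable paths with x_0 = y_0, and let x̂_t = (t, x_t), ŷ_t = (t, y_t) be their time augmentations. If Sig^w(x̂) = Sig^w(ŷ) for every word w over the alphabet {0,1,…,d} (equivalently, if ρ^Sig(x̂, ŷ) = 0), then x_t = y_t for all t ∈ [0,T]. Consequently, ρ^Sig is a genuine metric on the set of time-augmented continuously differentiable paths with a fixed initial value. -/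
open MeasureTheory

/-- Iterated integrals against the time coordinate alone are the monomials `t ^ k / k!`. -/
lemma sigAux_replicate {ι : Type*} (x' : ℝ → ι → ℝ) (j : ι) (hj : ∀ t, x' t j = 1)
    (k : ℕ) (t : ℝ) :
    sigAux x' (List.replicate k j) t = t ^ k / (k.factorial : ℝ) := by
  induction k generalizing t with
  | zero => simp [sigAux]
  | succ k ih =>
    simp only [List.replicate_succ, sigAux, hj, ih, one_mul]
    rw [intervalIntegral.integral_div, integral_pow, Nat.factorial_succ]
    push_cast
    field_simp
    simp

/-- A continuous function on `[a, b]` all of whose moments vanish is zero on `[a, b]`. -/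
lemma eqOn_zero_of_integral_mul_pow_eq_zero {a b : ℝ} (hab : a < b) {f : ℝ → ℝ}
    (hf : ContinuousOn f (Set.Icc a b)) (hmom : ∀ k : ℕ, ∫ s in a..b, f s * s ^ k = 0) :
    ∀ t ∈ Set.Icc a b, f t = 0 := by
  have huIcc : Set.uIcc a b = Set.Icc a b := Set.uIcc_of_le hab.le
  have hpoly (p : Polynomial ℝ) : ∫ s in a..b, f s * p.eval s = 0 := by
    simp only [Polynomial.eval_eq_sum_range, Finset.mul_sum]
    rw [intervalIntegral.integral_finsetSum]
    · refine Finset.sum_eq_zero fun k _ => ?_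
      simp only [mul_left_comm (f _)]
      rw [intervalIntegral.integral_const_mul, hmom, mul_zero]
    · intro k _
      refine ContinuousOn.intervalIntegrable ?_
      rw [huIcc]
      fun_prop
  obtain ⟨M, hM⟩ := isCompact_Icc.exists_bound_of_continuousOn hf
  have hM0 : 0 ≤ M := (norm_nonneg _).trans (hM a (Set.left_mem_Icc.2 hab.le))
  have hsq_le (ε : ℝ) (hε : 0 < ε) : ∫ s in a..b, f s * f s ≤ 0 + M * (b - a) * ε := by
    obtain ⟨p, hp⟩ := exists_polynomial_near_of_continuousOn a b f hf ε hε
    have hsplit : ∫ s in a..b, f s * f s = ∫ s in a..b, f s * (f s - p.eval s) := by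
      simp only [mul_sub]
      rw [intervalIntegral.integral_sub, hpoly, sub_zero] <;>
      · refine ContinuousOn.intervalIntegrable ?_
        rw [huIcc]
        fun_prop
    have hbound : ‖∫ s in a..b, f s * (f s - p.eval s)‖ ≤ M * ε * |b - a| := by
      refine intervalIntegral.norm_integral_le_of_norm_le_const fun s hs => ?_
      rw [Set.uIoc_of_le hab.le] at hs
      have hs' := Set.Ioc_subset_Icc_self hs
      rw [norm_mul, ← norm_neg (f s - _), neg_sub]
      exact mul_le_mul (hM s hs') (hp s hs').le (norm_nonneg _) hM0
    rw [abs_of_pos (sub_pos.2 hab)] at hbound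
    rw [hsplit]
    linarith [(le_abs_self _).trans hbound]
  have hsq : ∫ s in a..b, f s * f s ≤ 0 := by
    refine le_of_forall_pos_le_add fun δ hδ => ?_
    have hpos : 0 < M * (b - a) + 1 := by
      have := mul_nonneg hM0 (sub_pos.2 hab).le
      linarith
    refine (hsq_le (δ / (M * (b - a) + 1)) (by positivity)).trans ?_
    gcongr
    rw [← mul_div_assoc, div_le_iff₀ hpos]
    linarith
  intro t ht
  by_contra hne
  exact hsq.not_gt <| intervalIntegral.integral_pos hab (hf.mul hf)
    (fun s _ => mul_self_nonneg _) ⟨t, ht, mul_self_pos.2 hne⟩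

/-- if two continuously differentiable paths with the same initial
value have time augmentations `x̂_t = (t,x_t)`, `ŷ_t = (t,y_t)` (derivatives
`Fin.cons 1 (x' t)`, `Fin.cons 1 (y' t)`, coordinate `0` being time) with equal
signature coefficients for every word, then the paths coincide on `[0,T]`;
hence `ρ^Sig` is a genuine metric on time-augmented paths with fixed initial value. -/
theorem signature_determines_path
    (d : ℕ) (hd : 1 ≤ d) (T : ℝ) (hT : 0 < T)
    (x x' y y' : ℝ → Fin d → ℝ)
    (hxderiv : ∀ i : Fin d, ∀ t ∈ Set.Icc (0:ℝ) T,
      HasDerivAt (fun s => x s i) (x' t i) t)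
    (hxcont : ∀ i : Fin d, ContinuousOn (fun t => x' t i) (Set.Icc (0:ℝ) T))
    (hyderiv : ∀ i : Fin d, ∀ t ∈ Set.Icc (0:ℝ) T,
      HasDerivAt (fun s => y s i) (y' t i) t)
    (hycont : ∀ i : Fin d, ContinuousOn (fun t => y' t i) (Set.Icc (0:ℝ) T))
    (h0 : x 0 = y 0)
    (hsig : ∀ w : List (Fin (d + 1)),
      sigCoeff (fun t => Fin.cons 1 (x' t)) T w
        = sigCoeff (fun t => Fin.cons 1 (y' t)) T w) :
    ∀ t ∈ Set.Icc (0:ℝ) T, x t = y t := by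
  intro t ht
  funext i
  have hmoment (z' : ℝ → Fin d → ℝ) (k : ℕ) :
      sigCoeff (fun t => (Fin.cons 1 (z' t) : Fin (d + 1) → ℝ)) T
        (i.succ :: List.replicate k 0).reverse
        = (∫ s in (0:ℝ)..T, z' s i * s ^ k) / (k.factorial : ℝ) := by
    simp only [sigCoeff, List.reverse_reverse, sigAux, Fin.cons_succ]
    rw [← intervalIntegral.integral_div]
    congr 1
    funext s
    rw [sigAux_replicate _ _ (fun _ => Fin.cons_zero _ _), mul_div_assoc]
  have hzero := eqOn_zero_of_integral_mul_pow_eq_zero hT ((hxcont i).sub (hycont i)) fun k => by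
    have hk := hsig (i.succ :: List.replicate k 0).reverse
    rw [hmoment, hmoment, div_left_inj' (by positivity)] at hk
    simp only [Pi.sub_apply, sub_mul]
    rw [intervalIntegral.integral_sub, hk, sub_self]
    · refine ContinuousOn.intervalIntegrable ?_
      rw [Set.uIcc_of_le hT.le]
      exact (hxcont i).mul (by fun_prop)
    · refine ContinuousOn.intervalIntegrable ?_
      rw [Set.uIcc_of_le hT.le]
      exact (hycont i).mul (by fun_prop)
  refine eq_of_has_deriv_right_eq (f' := fun s => x' s i)
    (fun s hs => (hxderiv i s (Set.Ico_subset_Icc_self hs)).hasDerivWithinAt)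
    (fun s hs => ?_)
    (fun s hs => (hxderiv i s hs).continuousAt.continuousWithinAt)
    (fun s hs => (hyderiv i s hs).continuousAt.continuousWithinAt) (congrFun h0 i) t ht
  have hs' := Set.Ico_subset_Icc_self hs
  rw [show x' s i = y' s i from sub_eq_zero.1 (hzero s hs')]
  exact (hyderiv i s hs').hasDerivWithinAt
end

section
/- Let β ∈ (0,1], L > 0, and suppose F belongs to the Hölder class 𝓕_β^ρ with constant L. Fix x ∈ 𝒳 and suppose the concentration function has an exponential lower bound: there exist constants c, K̂, γ, h₀ > 0 with φ_x(h) ≥ c·exp(−K̂·h^{−γ}) for all h ∈ (0,h₀]. Fix ε ∈ (0,1) and take the bandwidth h = ((1−ε)·log M / K̂)^{−1/γ}. Then for every δ ∈ (0,1) there exists a constant C > 0 (depending on δ, R, L, b, B, c, K̂, γ, β, ε) such that for all sufficiently large M, with probability at least 1 − δ over the i.i.d. sample, |F̂(x) − F(x)| ≤ C·(log M)^{−β/γ}. -/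
open MeasureTheory

open Filter ProbabilityTheory

/-- Chebyshev's inequality for the sum of `M` i.i.d. copies of a square integrable function. -/
lemma measure_pi_le_abs_sum_sub_integral_le {Ω : Type*} [MeasurableSpace Ω] (P : Measure Ω)
    [IsProbabilityMeasure P] {f : Ω → ℝ} (hf : MemLp f 2 P) {V t : ℝ} (hV : ∫ p, f p ^ 2 ∂P ≤ V)
    (ht : 0 < t) (M : ℕ) :
    (Measure.pi fun _ : Fin M => P) {ω | t ≤ |∑ i, f (ω i) - M * ∫ p, f p ∂P|}
      ≤ ENNReal.ofReal (M * V / t ^ 2) := by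
  have hcomp : ∀ i : Fin M, MemLp (fun ω : Fin M → Ω => f (ω i)) 2 (Measure.pi fun _ => P) :=
    fun i => hf.comp_measurePreserving (measurePreserving_eval (fun _ : Fin M => P) i)
  have hsum : MemLp (∑ i : Fin M, fun ω : Fin M → Ω => f (ω i)) 2 (Measure.pi fun _ => P) :=
    memLp_finsetSum' _ fun i _ => hcomp i
  have hmean : ∫ ω, (∑ i : Fin M, fun ω : Fin M → Ω => f (ω i)) ω ∂(Measure.pi fun _ => P)
      = M * ∫ p, f p ∂P := by
    simp only [Finset.sum_apply]
    rw [integral_finsetSum _ fun i _ => (hcomp i).integrable one_le_two]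
    simp [integral_comp_eval (μ := fun _ : Fin M => P) hf.aestronglyMeasurable]
  have hvar : Var[∑ i : Fin M, fun ω : Fin M → Ω => f (ω i); Measure.pi fun _ => P] ≤ M * V := by
    rw [variance_sum_pi fun _ => hf]
    simp only [Finset.sum_const, Finset.card_univ, Fintype.card_fin, nsmul_eq_mul]
    gcongr
    exact (variance_le_expectation_sq hf.aestronglyMeasurable).trans hV
  have hcheb := meas_ge_le_variance_div_sq hsum ht
  rw [hmean] at hcheb
  simp only [Finset.sum_apply] at hcheb
  exact hcheb.trans (ENNReal.ofReal_le_ofReal (by gcongr))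

/-- A ratio `∑ Y k / ∑ k` is close to `a` once `Y = G + (Y - G)`, with `G` close to `a` on the
support of `k`, the noise sum `∑ (Y - G) k` is small and `∑ k` is not too small. -/
lemma abs_weighted_mean_sub_le {ι : Type*} (s : Finset ι) {Y G k : ι → ℝ} {a D t κ : ℝ}
    (hk : ∀ i, 0 ≤ k i) (hG : ∀ i, |G i - a| * k i ≤ D * k i) (hκ : 0 < κ) (ht : 0 ≤ t)
    (hS : κ / 2 < ∑ i ∈ s, k i) (hT : |∑ i ∈ s, (Y i - G i) * k i| ≤ t * κ) :
    |(∑ i ∈ s, Y i * k i) / (∑ i ∈ s, k i) - a| ≤ D + 2 * t := by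
  have hS0 : 0 < ∑ i ∈ s, k i := lt_trans (by positivity) hS
  have hdecomp : (∑ i ∈ s, Y i * k i) - a * ∑ i ∈ s, k i
      = ∑ i ∈ s, (Y i - G i) * k i + ∑ i ∈ s, (G i - a) * k i := by
    rw [Finset.mul_sum, ← Finset.sum_sub_distrib, ← Finset.sum_add_distrib]
    exact Finset.sum_congr rfl fun i _ => by ring
  have hbias : |∑ i ∈ s, (G i - a) * k i| ≤ D * ∑ i ∈ s, k i := by
    rw [Finset.mul_sum]
    refine (Finset.abs_sum_le_sum_abs _ _).trans (Finset.sum_le_sum fun i _ => ?_)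
    rw [abs_mul, abs_of_nonneg (hk i)]
    exact hG i
  have hnoise : t * κ ≤ 2 * t * ∑ i ∈ s, k i := by nlinarith
  rw [div_sub' hS0.ne', abs_div, abs_of_pos hS0, div_le_iff₀ hS0, mul_comm _ a, hdecomp]
  exact (abs_add_le _ _).trans (by linarith)

/-- Deviation bound for the weighted mean `∑ Y k / ∑ k` over an i.i.d. sample, where `G` plays the
role of the regression function of `Y`. -/
lemma ofReal_one_sub_le_measure_pi_weighted_mean {Ω : Type*} [MeasurableSpace Ω] (P : Measure Ω)
    [IsProbabilityMeasure P] {Y G k : Ω → ℝ} (hY : Measurable Y) (hG : Measurable G)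
    (hk : Measurable k) {A B D a t m δ : ℝ} (hk0 : ∀ p, 0 ≤ k p) (hkB : ∀ p, k p ≤ B)
    (hYG : ∀ᵐ p ∂P, |Y p - G p| ≤ A) (hGa : ∀ p, |G p - a| * k p ≤ D * k p)
    (hmean : ∫ p, (Y p - G p) * k p ∂P = 0) (ht : 0 < t) (hm : 0 < m) (hδ : 0 < δ) (M : ℕ)
    (hmM : m ≤ M * ∫ p, k p ∂P) (hS : 4 * B ≤ δ / 2 * m) (hT : A ^ 2 * B ≤ δ / 2 * (t ^ 2 * m)) :
    ENNReal.ofReal (1 - δ) ≤ (Measure.pi fun _ : Fin M => P)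
      {ω | |(∑ i, Y (ω i) * k (ω i)) / (∑ j, k (ω j)) - a| ≤ D + 2 * t} := by
  set κ := ∫ p, k p ∂P with hκ
  have hn : 0 < M * κ := hm.trans_le hmM
  have hkLp : MemLp k 2 P := MemLp.of_bound hk.aestronglyMeasurable B <|
    .of_forall fun p => by rw [Real.norm_eq_abs, abs_of_nonneg (hk0 p)]; exact hkB p
  have hkint : Integrable k P := hkLp.integrable one_le_two
  have hξLp : MemLp (fun p => (Y p - G p) * k p) 2 P :=
    MemLp.of_bound ((hY.sub hG).mul hk).aestronglyMeasurable (A * B) <| by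
      filter_upwards [hYG] with p hp
      rw [Real.norm_eq_abs, abs_mul, abs_of_nonneg (hk0 p)]
      exact mul_le_mul hp (hkB p) (hk0 p) ((abs_nonneg _).trans hp)
  have hksq : ∫ p, k p ^ 2 ∂P ≤ B * κ := by
    rw [hκ, ← integral_const_mul]
    refine integral_mono hkLp.integrable_sq (hkint.const_mul B) fun p => ?_
    simp only [sq]
    exact mul_le_mul_of_nonneg_right (hkB p) (hk0 p)
  have hξsq : ∫ p, ((Y p - G p) * k p) ^ 2 ∂P ≤ A ^ 2 * B * κ := by
    rw [hκ, ← integral_const_mul]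
    refine integral_mono_ae hξLp.integrable_sq (hkint.const_mul _) ?_
    filter_upwards [hYG] with p hp
    have h₁ : (Y p - G p) ^ 2 ≤ A ^ 2 := sq_le_sq' (abs_le.mp hp).1 (abs_le.mp hp).2
    have h₂ : k p ^ 2 ≤ B * k p := by nlinarith [hk0 p, hkB p]
    calc ((Y p - G p) * k p) ^ 2 = (Y p - G p) ^ 2 * k p ^ 2 := by ring
      _ ≤ A ^ 2 * (B * k p) := mul_le_mul h₁ h₂ (sq_nonneg _) (sq_nonneg _)
      _ = A ^ 2 * B * k p := by ring
  have hchebS := measure_pi_le_abs_sum_sub_integral_le P hkLp hksq (half_pos hn) M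
  have hchebT := measure_pi_le_abs_sum_sub_integral_le P hξLp hξsq (mul_pos ht hn) M
  have hboundS : M * (B * κ) / (M * κ / 2) ^ 2 ≤ δ / 2 := by
    rw [div_le_iff₀ (by positivity)]
    have : 4 * B ≤ δ / 2 * (M * κ) := hS.trans (by gcongr)
    nlinarith
  have hboundT : M * (A ^ 2 * B * κ) / (t * (M * κ)) ^ 2 ≤ δ / 2 := by
    rw [div_le_iff₀ (by positivity)]
    have : A ^ 2 * B ≤ δ / 2 * (t ^ 2 * (M * κ)) := hT.trans (by gcongr)
    nlinarith
  rw [hmean, mul_zero] at hchebT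
  simp only [sub_zero] at hchebT
  set good := {ω : Fin M → Ω |
    |(∑ i, Y (ω i) * k (ω i)) / (∑ j, k (ω j)) - a| ≤ D + 2 * t}
  have hbad : (Measure.pi fun _ : Fin M => P) goodᶜ ≤ ENNReal.ofReal δ := by
    calc (Measure.pi fun _ : Fin M => P) goodᶜ
        ≤ (Measure.pi fun _ : Fin M => P)
            ({ω | M * κ / 2 ≤ |∑ i, k (ω i) - M * κ|} ∪
              {ω | t * (M * κ) ≤ |∑ i, (Y (ω i) - G (ω i)) * k (ω i)|}) := by
          refine measure_mono fun ω hω => ?_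
          by_contra hcon
          simp only [Set.mem_union, Set.mem_ofPred_eq, not_or, not_le] at hcon
          refine hω (abs_weighted_mean_sub_le _ (fun i => hk0 (ω i)) (fun i => hGa (ω i)) hn ht.le
            ?_ hcon.2.le)
          linarith [(abs_lt.mp hcon.1).1]
      _ ≤ ENNReal.ofReal (δ / 2) + ENNReal.ofReal (δ / 2) :=
          (measure_union_le _ _).trans <| add_le_add
            (hchebS.trans (ENNReal.ofReal_le_ofReal hboundS))
            (hchebT.trans (ENNReal.ofReal_le_ofReal hboundT))
      _ = ENNReal.ofReal δ := by
          rw [← ENNReal.ofReal_add (by positivity) (by positivity), add_halves]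
  rw [ENNReal.ofReal_sub _ hδ.le, ENNReal.ofReal_one, tsub_le_iff_right]
  calc (1 : ENNReal) = (Measure.pi fun _ : Fin M => P) Set.univ := measure_univ.symm
    _ ≤ _ := measure_univ_le_add_compl good
    _ ≤ _ := by gcongr

/-- Powers `n ^ ε` eventually dominate powers of the logarithm along the natural numbers. -/
lemma eventually_mul_log_rpow_le {a d ε : ℝ} (r : ℝ) (ha : 0 ≤ a) (hd : 0 < d) (hε : 0 < ε) :
    ∀ᶠ M : ℕ in atTop, a * Real.log M ^ r ≤ d * (M : ℝ) ^ ε := by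
  have hlo := (isLittleO_log_rpow_rpow_atTop r hε).bound (c := d / (a + 1)) (by positivity)
  filter_upwards [tendsto_natCast_atTop_atTop.eventually hlo, eventually_ge_atTop 1] with M hM h1
  have hlog : 0 ≤ Real.log M ^ r := Real.rpow_nonneg (Real.log_natCast_nonneg M) _
  rw [Real.norm_of_nonneg hlog, Real.norm_of_nonneg (by positivity), div_mul_eq_mul_div,
    le_div_iff₀ (by positivity)] at hM
  nlinarith

/-- logarithmic nonparametric rate `(log M)^{−β/γ}` for the
functional Nadaraya–Watson estimator under an exponential small-ball lower bound
`φ_x(h) ≥ c·exp(−K̂·h^{−γ})`, with bandwidth `h = ((1−ε)·log M / K̂)^{−1/γ}`.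
(This is the quantitative content of the paper's theorem on learning the
Itô–Lyons map, where `γ = 1/2 − α`.) -/
theorem nadaraya_watson_logarithmic_rate
    {𝒳 : Type*} [MeasurableSpace 𝒳]
    (ρ : 𝒳 → 𝒳 → ℝ)
    (hρ_meas : Measurable fun p : 𝒳 × 𝒳 => ρ p.1 p.2)
    (hρ_nonneg : ∀ u v, 0 ≤ ρ u v)
    (hρ_symm : ∀ u v, ρ u v = ρ v u)
    (hρ_refl : ∀ u, ρ u u = 0)
    (hρ_tri : ∀ u v w, ρ u w ≤ ρ u v + ρ v w)
    (P : Measure (𝒳 × ℝ)) [IsProbabilityMeasure P]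
    (R : ℝ) (hR : 0 < R)
    (hY : ∀ᵐ p ∂P, |p.2| ≤ R)
    (F : 𝒳 → ℝ) (hF_meas : Measurable F) (hF_bdd : ∀ z, |F z| ≤ R)
    (hF_reg : ∀ g : 𝒳 → ℝ, Measurable g → (∃ Cg : ℝ, ∀ z, |g z| ≤ Cg) →
      ∫ p, p.2 * g p.1 ∂P = ∫ z, F z * g z ∂(P.map Prod.fst))
    (K : ℝ → ℝ) (hK_meas : Measurable K) (hK_nonneg : ∀ u, 0 ≤ K u)
    (b B : ℝ) (hb : 0 < b) (hbB : b ≤ B)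
    (hK_bounds : ∀ u : ℝ, 0 ≤ u →
      (Set.Icc (0:ℝ) 1).indicator (fun _ => b) u ≤ K u ∧
      K u ≤ (Set.Icc (0:ℝ) 1).indicator (fun _ => B) u)
    (β L : ℝ) (hβ : β ∈ Set.Ioc (0:ℝ) 1) (hL : 0 < L)
    (hHolder : ∀ u v, |F u - F v| ≤ L * ρ u v ^ β)
    (x : 𝒳)
    (c Khat γ h₀ : ℝ) (hc : 0 < c) (hKhat : 0 < Khat) (hγ : 0 < γ) (hh₀ : 0 < h₀)
    (hsmallball : ∀ h ∈ Set.Ioc (0:ℝ) h₀,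
      c * Real.exp (-Khat * h ^ (-γ)) ≤ ((P.map Prod.fst) {z | ρ z x ≤ h}).toReal)
    (ε : ℝ) (hε : ε ∈ Set.Ioo (0:ℝ) 1) :
    ∀ δ ∈ Set.Ioo (0:ℝ) 1, ∃ C > 0, ∃ M₀ : ℕ, ∀ M : ℕ, M₀ ≤ M →
      (Measure.pi fun _ : Fin M => P)
        {ω | |(∑ i, (ω i).2 *
                  K ((((1 - ε) * Real.log M / Khat) ^ (-(1 / γ)))⁻¹ * ρ x (ω i).1)) /
                (∑ j, K ((((1 - ε) * Real.log M / Khat) ^ (-(1 / γ)))⁻¹ * ρ x (ω j).1))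
              - F x|
            ≤ C * Real.log M ^ (-(β / γ))}
        ≥ ENNReal.ofReal (1 - δ) := by
  intro δ hδ
  obtain ⟨hε0, hε1⟩ := hε
  have hB : 0 < B := hb.trans_le hbB
  have hq : 0 < (1 - ε) / Khat := div_pos (by linarith) hKhat
  refine ⟨L * ((1 - ε) / Khat) ^ (-(β / γ)) + 1, by positivity, ?_⟩
  have htend : Tendsto (fun M : ℕ => ((1 - ε) * Real.log M / Khat) ^ (-(1 / γ))) atTop (nhds 0) := by
    refine (tendsto_rpow_neg_atTop (one_div_pos.mpr hγ)).comp ?_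
    have := (Real.tendsto_log_atTop.comp tendsto_natCast_atTop_atTop).const_mul_atTop hq
    refine this.congr fun M => ?_
    simp only [Function.comp_apply]
    ring
  rw [← eventually_atTop]
  filter_upwards [eventually_ge_atTop 2, htend.eventually_le_const hh₀,
    eventually_mul_log_rpow_le 0 (by positivity : 0 ≤ 4 * B)
      (mul_pos (half_pos hδ.1) (mul_pos hb hc)) hε0,
    eventually_mul_log_rpow_le (2 * (β / γ)) (by positivity : 0 ≤ (2 * R) ^ 2 * B * 4)
      (mul_pos (half_pos hδ.1) (mul_pos hb hc)) hε0] with M hM2 hh hS hT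
  have hM1 : (1 : ℝ) < M := by exact_mod_cast hM2
  have hM0 : (0 : ℝ) < M := by linarith
  have hlog : 0 < Real.log M := Real.log_pos hM1
  have hbase : 0 < (1 - ε) * Real.log M / Khat := by
    rw [mul_div_right_comm]; exact mul_pos hq hlog
  set h := ((1 - ε) * Real.log M / Khat) ^ (-(1 / γ)) with hh_def
  have hh0 : 0 < h := Real.rpow_pos_of_pos hbase _
  have hhγ : h ^ (-γ) = (1 - ε) * Real.log M / Khat := by
    rw [hh_def, ← Real.rpow_mul hbase.le, show -(1 / γ) * -γ = 1 by field_simp, Real.rpow_one]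
  have hhβ : h ^ β = ((1 - ε) / Khat) ^ (-(β / γ)) * Real.log M ^ (-(β / γ)) := by
    rw [hh_def, ← Real.rpow_mul hbase.le, mul_div_right_comm, Real.mul_rpow hq.le hlog.le,
      show -(1 / γ) * β = -(β / γ) by ring]
  have hball : c * (M : ℝ) ^ (-(1 - ε)) ≤ ((P.map Prod.fst) {z | ρ z x ≤ h}).toReal := by
    convert hsmallball h ⟨hh0, hh⟩ using 2
    rw [hhγ, Real.rpow_def_of_pos hM0]
    congr 1
    field_simp
  have hkB : ∀ z, K (h⁻¹ * ρ x z) ≤ B := fun z =>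
    (hK_bounds _ (mul_nonneg (inv_nonneg.mpr hh0.le) (hρ_nonneg x z))).2.trans
      (Set.indicator_le_self' (fun _ _ => hB.le) _)
  have hρx : Measurable fun z => ρ x z := hρ_meas.comp measurable_prodMk_left
  have hkm : Measurable fun z => K (h⁻¹ * ρ x z) := hK_meas.comp (hρx.const_mul _)
  have hkabs : ∀ z, |K (h⁻¹ * ρ x z)| ≤ B := fun z => by
    rw [abs_of_nonneg (hK_nonneg _)]; exact hkB z
  have hprob : IsProbabilityMeasure (P.map Prod.fst) :=
    Measure.isProbabilityMeasure_map measurable_fst.aemeasurable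
  have hFK : Integrable (fun p : 𝒳 × ℝ => F p.1 * K (h⁻¹ * ρ x p.1)) P :=
    .of_bound ((hF_meas.mul hkm).comp measurable_fst).aestronglyMeasurable (R * B) <|
      .of_forall fun p => by
        rw [Real.norm_eq_abs, abs_mul]
        exact mul_le_mul (hF_bdd _) (hkabs _) (abs_nonneg _) hR.le
  have hYK : Integrable (fun p : 𝒳 × ℝ => p.2 * K (h⁻¹ * ρ x p.1)) P :=
    .of_bound (measurable_snd.mul (hkm.comp measurable_fst)).aestronglyMeasurable (R * B) <| by
      filter_upwards [hY] with p hp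
      rw [Real.norm_eq_abs, abs_mul]
      exact mul_le_mul hp (hkabs _) (abs_nonneg _) hR.le
  have hmean : ∫ p : 𝒳 × ℝ, (p.2 - F p.1) * K (h⁻¹ * ρ x p.1) ∂P = 0 := by
    have hreg := hF_reg _ hkm ⟨B, hkabs⟩
    rw [integral_map (f := fun z => F z * K (h⁻¹ * ρ x z)) measurable_fst.aemeasurable
      (hF_meas.mul hkm).aestronglyMeasurable] at hreg
    simp only [sub_mul]
    rw [integral_sub hYK hFK, hreg, sub_self]
  have hbias : ∀ p : 𝒳 × ℝ,
      |F p.1 - F x| * K (h⁻¹ * ρ x p.1) ≤ L * h ^ β * K (h⁻¹ * ρ x p.1) := fun p => by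
    rcases le_or_gt (ρ x p.1) h with hle | hgt
    · refine mul_le_mul_of_nonneg_right ((hHolder _ _).trans ?_) (hK_nonneg _)
      rw [hρ_symm]
      exact mul_le_mul_of_nonneg_left (Real.rpow_le_rpow (hρ_nonneg _ _) hle hβ.1.le) hL.le
    · have hout : h⁻¹ * ρ x p.1 ∉ Set.Icc (0 : ℝ) 1 := fun hmem => by
        have := hmem.2
        rw [inv_mul_le_iff₀ hh0] at this
        linarith
      have hzero := (hK_bounds _ (mul_nonneg (inv_nonneg.mpr hh0.le) (hρ_nonneg x p.1))).2
      rw [Set.indicator_of_notMem hout] at hzero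
      simp [le_antisymm hzero (hK_nonneg _)]
  have hκ : b * ((P.map Prod.fst) {z | ρ z x ≤ h}).toReal ≤ ∫ p, K (h⁻¹ * ρ x p.1) ∂P := by
    have hmeas : MeasurableSet {z | ρ z x ≤ h} := by
      simp only [fun z => hρ_symm z x]
      exact measurableSet_le hρx measurable_const
    rw [← integral_map (f := fun z => K (h⁻¹ * ρ x z)) measurable_fst.aemeasurable
        hkm.aestronglyMeasurable, mul_comm, ← smul_eq_mul]
    change (P.map Prod.fst).real {z | ρ z x ≤ h} • b ≤ _
    rw [← integral_indicator_const b hmeas]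
    refine integral_mono ((integrable_const b).indicator hmeas)
      (.of_bound hkm.aestronglyMeasurable B (.of_forall hkabs)) fun z => ?_
    refine Set.indicator_le' (g := fun z => K (h⁻¹ * ρ x z)) (fun z hz => ?_)
      (fun z _ => hK_nonneg _) z
    have hnn := mul_nonneg (inv_nonneg.mpr hh0.le) (hρ_nonneg x z)
    have hlow := (hK_bounds _ hnn).1
    rwa [Set.indicator_of_mem] at hlow
    refine ⟨hnn, ?_⟩
    rw [inv_mul_le_iff₀ hh0, mul_one, hρ_symm]
    exact hz
  have hpow : (M : ℝ) * (M : ℝ) ^ (-(1 - ε)) = (M : ℝ) ^ ε := by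
    rw [← Real.rpow_one_add' hM0.le (by linarith)]
    congr 1
    ring
  have hm : b * c * (M : ℝ) ^ ε ≤ M * ∫ p, K (h⁻¹ * ρ x p.1) ∂P := by
    rw [← hpow]
    calc b * c * ((M : ℝ) * (M : ℝ) ^ (-(1 - ε)))
        = M * (b * (c * (M : ℝ) ^ (-(1 - ε)))) := by ring
      _ ≤ _ := by
        gcongr
        exact (mul_le_mul_of_nonneg_left hball hb.le).trans hκ
  have hℓ : 0 < Real.log M ^ (-(β / γ)) := Real.rpow_pos_of_pos hlog _
  have hℓsq : Real.log M ^ (2 * (β / γ)) * (Real.log M ^ (-(β / γ))) ^ 2 = 1 := by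
    rw [← Real.rpow_natCast, ← Real.rpow_mul hlog.le, ← Real.rpow_add hlog]
    convert Real.rpow_zero _ using 2
    push_cast
    ring
  have hmain := ofReal_one_sub_le_measure_pi_weighted_mean P (A := 2 * R)
    (t := Real.log M ^ (-(β / γ)) / 2) (m := b * c * (M : ℝ) ^ ε) measurable_snd
    (hF_meas.comp measurable_fst) (hkm.comp measurable_fst) (fun p => hK_nonneg _)
    (fun p => hkB p.1)
    (by
      filter_upwards [hY] with p hp
      exact (abs_sub _ _).trans (by simpa [two_mul] using add_le_add hp (hF_bdd p.1)))
    hbias hmean (half_pos hℓ) (by positivity) hδ.1 M hm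
    (by rw [Real.rpow_zero] at hS; linarith)
    (by
      have := mul_le_mul_of_nonneg_right hT (sq_nonneg (Real.log M ^ (-(β / γ))))
      rw [mul_assoc, hℓsq] at this
      linarith)
  rw [hhβ, mul_div_cancel₀ _ two_ne_zero, ← mul_assoc, ← add_one_mul] at hmain
  exact hmain
end
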